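/- arXiv:1508.02380 — 9 statements merged into one kernel-verified Lean document; each statement's English description precedes it below -/
import Mathlib

section
/- Let S be a dense subset of ℝ². Then h(S) ≤ 4; that is, for every finite family F₁, …, F_m of convex subsets of ℝ², if every subfamily of at most 4 of the sets has a common point belonging to S, then all m sets have a common point belonging to S. -/
/-- `HellyLe S n` (the `S`-Helly number is at most `n`): for every finite family of convex
subsets of `ℝ^d`, if every subfamily of at most `n` of the sets has a common point belonging
to `S`, then the whole family has a common point belonging to `S`. -/
def HellyLe {d : ℕ} (S : Set (EuclideanSpace ℝ (Fin d))) (n : ℕ) : Prop :=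
  ∀ (m : ℕ) (F : Fin m → Set (EuclideanSpace ℝ (Fin d))),
    (∀ i, Convex ℝ (F i)) →
    (∀ I : Finset (Fin m), I.card ≤ n → (S ∩ ⋂ i ∈ I, F i).Nonempty) →
    (S ∩ ⋂ i, F i).Nonempty

/-- Twice the signed area of the triangle `a b c` in the plane. -/
def signedArea (a b c : EuclideanSpace ℝ (Fin 2)) : ℝ :=
  (b 0 - a 0) * (c 1 - a 1) - (b 1 - a 1) * (c 0 - a 0)

lemma continuous_signedArea {X : Type*} [TopologicalSpace X]
    {f g h : X → EuclideanSpace ℝ (Fin 2)} (hf : Continuous f) (hg : Continuous g)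
    (hh : Continuous h) : Continuous fun x ↦ signedArea (f x) (g x) (h x) := by
  unfold signedArea
  fun_prop

/-- A point whose barycentric coordinates with respect to a triangle are positive is interior
to that triangle. -/
lemma mem_interior_triangle {p q x w : EuclideanSpace ℝ (Fin 2)}
    (h₁ : 0 < signedArea w q x * signedArea p q x)
    (h₂ : 0 < signedArea p w x * signedArea p q x)
    (h₃ : 0 < signedArea p q w * signedArea p q x) :
    w ∈ interior (convexHull ℝ {p, q, x}) := by
  have hD : signedArea p q x ≠ 0 := right_ne_zero_of_mul h₁.ne'
  rw [mem_interior]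
  refine ⟨{v | 0 < signedArea v q x * signedArea p q x} ∩
    {v | 0 < signedArea p v x * signedArea p q x} ∩
    {v | 0 < signedArea p q v * signedArea p q x}, ?_, ?_, ⟨⟨h₁, h₂⟩, h₃⟩⟩
  · rintro v ⟨⟨h₁, h₂⟩, h₃⟩
    simp only [Set.mem_ofPred_eq] at h₁ h₂ h₃
    rw [convexHull_insert (by simp), convexHull_pair, mem_convexJoin]
    have key : ∀ t : ℝ, 0 < t * signedArea p q x → 0 < t / signedArea p q x := fun t ht ↦ by
      rw [← mul_div_mul_right t _ hD]
      exact div_pos ht (mul_self_pos.2 hD)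
    have k₁ := key _ h₁
    have k₂ := key _ h₂
    have k₃ := key _ h₃
    set α := signedArea v q x / signedArea p q x with hα
    set β := signedArea p v x / signedArea p q x with hβ
    set γ := signedArea p q v / signedArea p q x with hγ
    have hsum : α + β + γ = 1 := by
      rw [hα, hβ, hγ]
      field_simp
      simp only [signedArea]
      ring
    have hv : v = α • p + β • q + γ • x := by
      ext i
      have : signedArea p q x * v i = signedArea v q x * p i + signedArea p v x * q i +
          signedArea p q v * x i := by
        fin_cases i <;> simp [signedArea] <;> ring
      simp only [PiLp.add_apply, PiLp.smul_apply, smul_eq_mul, hα, hβ, hγ]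
      field_simp
      linarith
    refine ⟨p, rfl, (β / (β + γ)) • q + (γ / (β + γ)) • x,
      ⟨_, _, by positivity, by positivity, by field_simp, rfl⟩,
      α, β + γ, k₁.le, by positivity, by linarith, ?_⟩
    rw [hv, smul_add, smul_smul, smul_smul, mul_div_cancel₀ _ (by positivity),
      mul_div_cancel₀ _ (by positivity), add_assoc]
  · refine ((isOpen_lt continuous_const ?_).inter (isOpen_lt continuous_const ?_)).inter
      (isOpen_lt continuous_const ?_) <;>
    exact (continuous_signedArea (by fun_prop) (by fun_prop) (by fun_prop)).mul continuous_const

open scoped Topology in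
/-- Two triangles on the same side of a common edge have a common interior point. -/
lemma exists_mem_interior_triangles {p q x y : EuclideanSpace ℝ (Fin 2)}
    (h : 0 < signedArea p q x * signedArea p q y) :
    ∃ w, w ∈ interior (convexHull ℝ {p, q, x}) ∧ w ∈ interior (convexHull ℝ {p, q, y}) := by
  have hx : signedArea p q x ≠ 0 := left_ne_zero_of_mul h.ne'
  have hy : signedArea p q y ≠ 0 := right_ne_zero_of_mul h.ne'
  let w : ℝ → EuclideanSpace ℝ (Fin 2) := fun u ↦ ((1 - u) / 2) • p + ((1 - u) / 2) • q + u • y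
  have hw : Continuous w := by fun_prop
  have near : ∀ f : ℝ → ℝ, Continuous f → 0 < f 0 → ∀ᶠ u in 𝓝[>] (0 : ℝ), 0 < f u :=
    fun f hf h0 ↦ (hf.continuousAt.eventually_const_lt h0).filter_mono nhdsWithin_le_nhds
  have e₁ := near (fun u ↦ signedArea (w u) q x * signedArea p q x)
    ((continuous_signedArea hw continuous_const continuous_const).mul continuous_const) (by
      have : signedArea (w 0) q x * signedArea p q x = signedArea p q x ^ 2 / 2 := by
        simp [w, signedArea]; ring
      simp only [this]; positivity)
  have e₂ := near (fun u ↦ signedArea p (w u) x * signedArea p q x)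
    ((continuous_signedArea continuous_const hw continuous_const).mul continuous_const) (by
      have : signedArea p (w 0) x * signedArea p q x = signedArea p q x ^ 2 / 2 := by
        simp [w, signedArea]; ring
      simp only [this]; positivity)
  have e₃ := near (fun u ↦ 1 - u) (by fun_prop) (by norm_num)
  obtain ⟨u, h₁, h₂, h₃, hu⟩ := (e₁.and (e₂.and (e₃.and self_mem_nhdsWithin))).exists
  replace hu : 0 < u := hu
  refine ⟨w u, mem_interior_triangle h₁ h₂ ?_, mem_interior_triangle ?_ ?_ ?_⟩
  · have : signedArea p q (w u) * signedArea p q x =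
        u * (signedArea p q x * signedArea p q y) := by
      simp [w, signedArea]; ring
    rw [this]; positivity
  · have : signedArea (w u) q y * signedArea p q y = (1 - u) / 2 * signedArea p q y ^ 2 := by
      simp [w, signedArea]; ring
    rw [this]; positivity
  · have : signedArea p (w u) y * signedArea p q y = (1 - u) / 2 * signedArea p q y ^ 2 := by
      simp [w, signedArea]; ring
    rw [this]; positivity
  · have : signedArea p q (w u) * signedArea p q y = u * signedArea p q y ^ 2 := by
      simp [w, signedArea]; ring
    rw [this]; positivity

lemma collinear_of_signedArea_eq_zero {p q x : EuclideanSpace ℝ (Fin 2)}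
    (h : signedArea p q x = 0) : Collinear ℝ {p, q, x} := by
  rcases eq_or_ne q p with rfl | hqp
  · simpa using collinear_pair ℝ q x
  rw [collinear_iff_of_mem (Set.mem_insert p _)]
  have hn : (q 0 - p 0) ^ 2 + (q 1 - p 1) ^ 2 ≠ 0 := fun h0 ↦ hqp <| by
    ext i
    fin_cases i <;> simp <;> nlinarith [sq_nonneg (q 0 - p 0), sq_nonneg (q 1 - p 1)]
  refine ⟨q - p, ?_⟩
  simp only [Set.mem_insert_iff, Set.mem_singleton_iff, forall_eq_or_imp, forall_eq]
  refine ⟨⟨0, by simp⟩, ⟨1, by simp⟩, ⟨((x 0 - p 0) * (q 0 - p 0) + (x 1 - p 1) * (q 1 - p 1)) /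
    ((q 0 - p 0) ^ 2 + (q 1 - p 1) ^ 2), ?_⟩⟩
  unfold signedArea at h
  ext i
  fin_cases i <;> simp <;> field_simp
  · linear_combination (-(q 1 - p 1)) * h
  · linear_combination (q 0 - p 0) * h

/-- If no point of a planar family lies in the convex hull of the others, then no three
of its points are collinear. -/
lemma signedArea_ne_zero_of_notMem_convexHull {ι : Type*}
    {a : ι → EuclideanSpace ℝ (Fin 2)} (ha : ∀ i, a i ∉ convexHull ℝ (a '' {i}ᶜ))
    {i j k : ι} (hij : i ≠ j) (hik : i ≠ k) (hjk : j ≠ k) :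
    signedArea (a i) (a j) (a k) ≠ 0 := by
  have not_between : ∀ r s t : ι, r ≠ s → t ≠ s → ¬ Wbtw ℝ (a r) (a s) (a t) :=
    fun r s t hr ht hw ↦ ha s <| segment_subset_convexHull
      (Set.mem_image_of_mem a hr) (Set.mem_image_of_mem a ht) (mem_segment_iff_wbtw.2 hw)
  intro h
  rcases (collinear_of_signedArea_eq_zero h).wbtw_or_wbtw_or_wbtw with h | h | h
  · exact not_between _ _ _ hij hjk.symm h
  · exact not_between _ _ _ hjk hik h
  · exact not_between _ _ _ hik.symm hij.symm h

/-- Among three nonzero reals, two have the same sign. -/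
lemma mul_pos_of_three {a b c : ℝ} (ha : a ≠ 0) (hb : b ≠ 0) (hc : c ≠ 0) :
    0 < a * b ∨ 0 < a * c ∨ 0 < b * c := by
  rcases ha.lt_or_gt with ha | ha <;> rcases hb.lt_or_gt with hb | hb <;>
    rcases hc.lt_or_gt with hc | hc <;>
    simp [mul_pos_of_neg_of_neg, *]

/-- For five points in convex position in the plane, the convex hulls of the subfamilies of four
points have a common interior point. -/
lemma nonempty_iInter_interior_convexHull {a : Fin 5 → EuclideanSpace ℝ (Fin 2)}
    (ha : ∀ i, a i ∉ convexHull ℝ (a '' {i}ᶜ)) :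
    (⋂ i, interior (convexHull ℝ (a '' {i}ᶜ))).Nonempty := by
  have hfr : Module.finrank ℝ (EuclideanSpace ℝ (Fin 2)) = 2 := by simp
  have key := Convex.helly_theorem (𝕜 := ℝ) (s := (Finset.univ : Finset (Fin 5)))
    (F := fun i ↦ interior (convexHull ℝ (a '' {i}ᶜ))) (by simp)
    (fun i _ ↦ (convex_convexHull ℝ _).interior) ?_
  · simpa using key
  intro I _ hI
  rw [hfr] at hI
  obtain ⟨x, y, z, hxy, hxz, hyz, rfl⟩ := Finset.card_eq_three.1 hI
  obtain ⟨p, q, hpq, hI'⟩ := Finset.card_eq_two.1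
    (show ({x, y, z} : Finset (Fin 5))ᶜ.card = 2 by rw [Finset.card_compl, hI]; rfl)
  have hp : p ∈ ({x, y, z} : Finset (Fin 5))ᶜ := by simp [hI']
  have hq : q ∈ ({x, y, z} : Finset (Fin 5))ᶜ := by simp [hI']
  simp only [Finset.mem_compl, Finset.mem_insert, Finset.mem_singleton, not_or] at hp hq
  obtain ⟨hpx, hpy, hpz⟩ := hp
  obtain ⟨hqx, hqy, hqz⟩ := hq
  have mono : ∀ r s : Fin 5, p ≠ s → q ≠ s → r ≠ s →
      interior (convexHull ℝ {a p, a q, a r}) ⊆ interior (convexHull ℝ (a '' {s}ᶜ)) := by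
    refine fun r s h₁ h₂ h₃ ↦ interior_mono (convexHull_mono ?_)
    rintro _ (rfl | rfl | rfl)
    exacts [⟨p, h₁, rfl⟩, ⟨q, h₂, rfl⟩, ⟨r, h₃, rfl⟩]
  simp only [Finset.mem_insert, Finset.mem_singleton, Set.iInter_iInter_eq_or_left,
    Set.iInter_iInter_eq_left]
  rcases mul_pos_of_three (signedArea_ne_zero_of_notMem_convexHull ha hpq hpx hqx)
    (signedArea_ne_zero_of_notMem_convexHull ha hpq hpy hqy)
    (signedArea_ne_zero_of_notMem_convexHull ha hpq hpz hqz) with h | h | h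
  · obtain ⟨w, h₁, h₂⟩ := exists_mem_interior_triangles h
    exact ⟨w, mono y x hpx hqx hxy.symm h₂, mono x y hpy hqy hxy h₁, mono x z hpz hqz hxz h₁⟩
  · obtain ⟨w, h₁, h₂⟩ := exists_mem_interior_triangles h
    exact ⟨w, mono z x hpx hqx hxz.symm h₂, mono x y hpy hqy hxy h₁, mono x z hpz hqz hxz h₁⟩
  · obtain ⟨w, h₁, h₂⟩ := exists_mem_interior_triangles h
    exact ⟨w, mono y x hpx hqx hxy.symm h₁, mono z y hpy hqy hyz.symm h₂, mono y z hpz hqz hyz h₁⟩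

/-- For five points of a dense planar set `S`, the convex hulls of the subfamilies of four points
have a common point in `S`. -/
lemma exists_mem_forall_mem_convexHull {S : Set (EuclideanSpace ℝ (Fin 2))} (hS : Dense S)
    (a : Fin 5 → EuclideanSpace ℝ (Fin 2)) (haS : ∀ i, a i ∈ S) :
    ∃ w ∈ S, ∀ i, w ∈ convexHull ℝ (a '' {i}ᶜ) := by
  by_cases h : ∃ i, a i ∈ convexHull ℝ (a '' {i}ᶜ)
  · obtain ⟨i, hi⟩ := h
    refine ⟨a i, haS i, fun j ↦ ?_⟩
    rcases eq_or_ne i j with rfl | hij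
    · exact hi
    · exact subset_convexHull ℝ _ (Set.mem_image_of_mem a hij)
  · obtain ⟨w, hw, hwS⟩ := hS.inter_open_nonempty _
      (isOpen_iInter_of_finite fun _ ↦ isOpen_interior)
      (nonempty_iInter_interior_convexHull (not_exists.1 h))
    exact ⟨w, hwS, fun i ↦ interior_subset (Set.mem_iInter.1 hw i)⟩

/-- If `S` is a dense subset of `ℝ²`, then `h(S) ≤ 4`. -/
theorem helly_of_dense_plane (S : Set (EuclideanSpace ℝ (Fin 2))) (hS : Dense S) :
    HellyLe S 4 := by
  intro m F hF h
  suffices ∀ J : Finset (Fin m), (S ∩ ⋂ i ∈ J, F i).Nonempty by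
    simpa using this Finset.univ
  intro J
  induction J using Finset.strongInduction with
  | H J ih =>
    rcases le_or_gt J.card 4 with hJ | hJ
    · exact h J hJ
    choose! a ha using fun i (hi : i ∈ J) ↦ ih (J.erase i) (Finset.erase_ssubset hi)
    obtain ⟨K, hKJ, hK⟩ := Finset.exists_subset_card_eq (show 5 ≤ J.card from hJ)
    let e : Fin 5 → Fin m := K.orderEmbOfFin hK
    have heJ : ∀ k, e k ∈ J := fun k ↦ hKJ (K.orderEmbOfFin_mem hK k)
    have hmem : ∀ k, ∀ j ∈ J, j ≠ e k → a (e k) ∈ F j := fun k j hj hjk ↦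
      Set.mem_iInter₂.1 (ha _ (heJ k)).2 j (Finset.mem_erase.2 ⟨hjk, hj⟩)
    obtain ⟨w, hwS, hw⟩ := exists_mem_forall_mem_convexHull hS (fun k ↦ a (e k))
      fun k ↦ (ha _ (heJ k)).1
    refine ⟨w, hwS, Set.mem_iInter₂.2 fun j hj ↦ ?_⟩
    obtain ⟨k, hk⟩ : ∃ k, ∀ i, i ≠ k → j ≠ e i := by
      by_cases hjK : ∃ k, j = e k
      · obtain ⟨k, rfl⟩ := hjK
        exact ⟨k, fun i hik hki ↦ hik ((K.orderEmbOfFin hK).injective hki).symm⟩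
      · exact ⟨0, fun i _ hi ↦ hjK ⟨i, hi⟩⟩
    refine convexHull_min ?_ (hF j) (hw k)
    rintro _ ⟨i, hi, rfl⟩
    exact hmem i j hj (hk i hi)
end

section
/- Let L be a proper additive subgroup of ℤ² (i.e., L is a subgroup of ℤ² with L ≠ ℤ²) and let S = ℤ² \ L. Then h(S) ≤ 6; that is, for every finite family F₁, …, F_m of convex subsets of ℝ², if every subfamily of at most 6 of the sets has a common point belonging to S, then all m sets have a common point belonging to S. -/
/-- `C` is the set of lattice points of a convex lattice polygon with vertex set `X`, in the
form of the two facts needed: `C` is closed under lattice barycentres of triples, and each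
vertex is exposed by an additive functional. -/
structure IsLatticePolygon (C : Set (Fin 2 → ℤ)) (X : Finset (Fin 2 → ℤ)) : Prop where
  subset : ∀ x ∈ X, x ∈ C
  convex : ∀ a ∈ C, ∀ b ∈ C, ∀ c ∈ C, ∀ i j k : ℤ, 0 ≤ i → 0 ≤ j → 0 ≤ k → 0 < i + j + k →
    ∀ p : Fin 2 → ℤ, (i + j + k) • p = i • a + j • b + k • c → p ∈ C
  exposed : ∀ x ∈ X, ∃ f : (Fin 2 → ℤ) →+ ℝ, ∀ y ∈ C, y ≠ x → f y < f x

/-- The determinant of two vectors of `ℤ²`. -/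
def cross (b c : Fin 2 → ℤ) : ℤ := b 0 * c 1 - b 1 * c 0

theorem cross_smul_eq (b c z : Fin 2 → ℤ) :
    cross b c • z = cross z c • b + cross b z • c := by
  ext e
  fin_cases e <;> simp [cross] <;> ring

/-- A subgroup of `ℤ²` containing every lattice point of a nondegenerate lattice triangle with
a vertex at the origin is everything. -/
theorem eq_top_of_triangle_of_pos (L : AddSubgroup (Fin 2 → ℤ)) (b c : Fin 2 → ℤ)
    (hD : 0 < cross b c) (hb : b ∈ L) (hc : c ∈ L)
    (h : ∀ p : Fin 2 → ℤ, ∀ i j k : ℤ, 0 ≤ i → 0 ≤ j → 0 ≤ k → 0 < i + j + k →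
      (i + j + k) • p = i • b + j • c → p ∈ L) : L = ⊤ := by
  rw [AddSubgroup.eq_top_iff']
  intro z
  set D := cross b c
  set s := cross z c
  set t := cross b z
  have hz : D • z = s • b + t • c := cross_smul_eq b c z
  have hs := Int.emod_add_mul_ediv s D
  have ht := Int.emod_add_mul_ediv t D
  have hs0 := Int.emod_nonneg s hD.ne'
  have ht0 := Int.emod_nonneg t hD.ne'
  have hs1 := Int.emod_lt_of_pos s hD
  have ht1 := Int.emod_lt_of_pos t hD
  set s0 := s % D
  set t0 := t % D
  set s' := s / D
  set t' := t / D
  have hlat : s' • b + t' • c ∈ L := L.add_mem (L.zsmul_mem hb _) (L.zsmul_mem hc _)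
  have hz' : D • (z - (s' • b + t' • c)) = s0 • b + t0 • c := by
    rw [smul_sub, hz, ← hs, ← ht]
    module
  suffices hw : z - (s' • b + t' • c) ∈ L by
    simpa using L.add_mem hw hlat
  rcases le_or_gt (s0 + t0) D with hle | hgt
  · refine h _ s0 t0 (D - s0 - t0) hs0 ht0 (by linarith) (by linarith) ?_
    rw [← hz']
    congr 1
    ring
  · have : b + c - (z - (s' • b + t' • c)) ∈ L := by
      refine h _ (D - s0) (D - t0) (s0 + t0 - D) (by linarith) (by linarith) (by linarith)
        (by linarith) ?_
      have e : D - s0 + (D - t0) + (s0 + t0 - D) = D := by ring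
      rw [e, smul_sub, hz']
      module
    simpa using L.sub_mem (L.add_mem hb hc) this

theorem eq_top_of_triangle (L : AddSubgroup (Fin 2 → ℤ)) (b c : Fin 2 → ℤ)
    (hD : cross b c ≠ 0) (hb : b ∈ L) (hc : c ∈ L)
    (h : ∀ p : Fin 2 → ℤ, ∀ i j k : ℤ, 0 ≤ i → 0 ≤ j → 0 ≤ k → 0 < i + j + k →
      (i + j + k) • p = i • b + j • c → p ∈ L) : L = ⊤ := by
  rcases lt_or_gt_of_ne hD with hneg | hpos
  · refine eq_top_of_triangle_of_pos L c b ?_ hc hb ?_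
    · simp only [cross] at hneg ⊢
      linarith
    · intro p i j k hi hj hk hpos hp
      refine h p j i k hj hi hk (by linarith) ?_
      rw [add_comm j i, hp, add_comm]
  · exact eq_top_of_triangle_of_pos L b c hpos hb hc h

namespace IsLatticePolygon

variable {C : Set (Fin 2 → ℤ)} {X : Finset (Fin 2 → ℤ)}

/-- A vertex is not a barycentre of other points of the polygon. -/
theorem not_barycentre (h : IsLatticePolygon C X) {x a b c : Fin 2 → ℤ} (hx : x ∈ X)
    (ha : a ∈ C) (hb : b ∈ C) (hc : c ∈ C) (hax : a ≠ x) (hbx : b ≠ x) (hcx : c ≠ x)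
    {i j k : ℤ} (hi : 0 ≤ i) (hj : 0 ≤ j) (hk : 0 ≤ k) (hpos : 0 < i + j + k)
    (he : (i + j + k) • x = i • a + j • b + k • c) : False := by
  obtain ⟨f, hf⟩ := h.exposed x hx
  have e := congrArg f he
  rw [map_zsmul, map_add, map_add, map_zsmul, map_zsmul, map_zsmul] at e
  simp only [zsmul_eq_mul] at e
  push_cast at e
  have hi' : (0 : ℝ) ≤ i := by exact_mod_cast hi
  have hj' : (0 : ℝ) ≤ j := by exact_mod_cast hj
  have hk' : (0 : ℝ) ≤ k := by exact_mod_cast hk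
  have hpos' : (0 : ℝ) < i + j + k := by exact_mod_cast hpos
  obtain ⟨δ, hδ, h1, h2, h3⟩ : ∃ δ > 0, f a ≤ f x - δ ∧ f b ≤ f x - δ ∧ f c ≤ f x - δ := by
    have h1 := hf a ha hax
    have h2 := hf b hb hbx
    have h3 := hf c hc hcx
    refine ⟨min (f x - f a) (min (f x - f b) (f x - f c)), ?_, ?_, ?_, ?_⟩
    · simp [h1, h2, h3]
    · linarith [min_le_left (f x - f a) (min (f x - f b) (f x - f c))]
    · linarith [min_le_right (f x - f a) (min (f x - f b) (f x - f c)),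
        min_le_left (f x - f b) (f x - f c)]
    · linarith [min_le_right (f x - f a) (min (f x - f b) (f x - f c)),
        min_le_right (f x - f b) (f x - f c)]
  nlinarith [mul_le_mul_of_nonneg_left h1 hi', mul_le_mul_of_nonneg_left h2 hj',
    mul_le_mul_of_nonneg_left h3 hk', mul_pos hpos' hδ]

theorem not_between (h : IsLatticePolygon C X) {x a b : Fin 2 → ℤ} (hx : x ∈ X)
    (ha : a ∈ C) (hb : b ∈ C) (hax : a ≠ x) (hbx : b ≠ x)
    {i j : ℤ} (hi : 0 ≤ i) (hj : 0 ≤ j) (hpos : 0 < i + j)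
    (he : (i + j) • x = i • a + j • b) : False :=
  h.not_barycentre hx ha hb hb hax hbx hbx hi hj le_rfl (by simpa using hpos) (by simpa using he)

theorem cross_ne_zero (h : IsLatticePolygon C X) {x y z : Fin 2 → ℤ} (hx : x ∈ X) (hy : y ∈ X)
    (hz : z ∈ X) (hxy : x ≠ y) (hxz : x ≠ z) (hyz : y ≠ z) : cross (y - x) (z - x) ≠ 0 := by
  intro h0
  simp only [cross, Pi.sub_apply] at h0
  set N : ℤ := (y 0 - x 0) ^ 2 + (y 1 - x 1) ^ 2 with hN
  set t : ℤ := (y 0 - x 0) * (z 0 - x 0) + (y 1 - x 1) * (z 1 - x 1) with ht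
  have hNpos : 0 < N := by
    rcases (by positivity : 0 ≤ N).eq_or_lt with h1 | h1
    · exfalso
      apply hxy
      have h2 : y 0 - x 0 = 0 := by nlinarith [sq_nonneg (y 0 - x 0), sq_nonneg (y 1 - x 1)]
      have h3 : y 1 - x 1 = 0 := by nlinarith [sq_nonneg (y 0 - x 0), sq_nonneg (y 1 - x 1)]
      ext e
      fin_cases e
      · simp; linarith
      · simp; linarith
    · exact h1
  have key : N • z = (N - t) • x + t • y := by
    ext e
    fin_cases e
    · simp [hN, ht]
      linear_combination (-(y 1 - x 1)) * h0
    · simp [hN, ht]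
      linear_combination (y 0 - x 0) * h0
  rcases lt_or_ge t 0 with ht0 | ht0
  · refine h.not_between hx (h.subset z hz) (h.subset y hy) hxz.symm hxy.symm (i := N) (j := -t)
      hNpos.le (by linarith) (by linarith) ?_
    rw [key]; module
  · rcases le_or_gt t N with htN | htN
    · refine h.not_between hz (h.subset x hx) (h.subset y hy) hxz hyz (i := N - t) (j := t)
        (by linarith) ht0 (by linarith) ?_
      rw [← key]; congr 1; ring
    · refine h.not_between hy (h.subset z hz) (h.subset x hx) hyz.symm hxy (i := N) (j := t - N)
        hNpos.le (by linarith) (by linarith) ?_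
      rw [key]; module

/-- If the non-vertices all lie in a proper subgroup, they are collinear. -/
theorem cross_eq_zero (h : IsLatticePolygon C X) {L : AddSubgroup (Fin 2 → ℤ)} (hL : L ≠ ⊤)
    (hCL : ∀ p ∈ C, p ∉ X → p ∈ L) {a b c : Fin 2 → ℤ} (ha : a ∈ C) (hb : b ∈ C) (hc : c ∈ C)
    (haX : a ∉ X) (hbX : b ∉ X) (hcX : c ∉ X) : cross (b - a) (c - a) = 0 := by
  by_contra h0
  have haL := hCL a ha haX
  refine hL (eq_top_of_triangle L _ _ h0 (L.sub_mem (hCL b hb hbX) haL)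
    (L.sub_mem (hCL c hc hcX) haL) ?_)
  intro p i j k hi hj hk hpos hp
  have e : (i + j + k) • (p + a) = i • b + j • c + k • a := by
    rw [smul_add, hp]; module
  have hpC : p + a ∈ C := h.convex b hb c hc a ha i j k hi hj hk hpos _ e
  have hpX : p + a ∉ X := fun hpX ↦ h.not_barycentre hpX hb hc ha
    (fun h ↦ hbX (h ▸ hpX)) (fun h ↦ hcX (h ▸ hpX)) (fun h ↦ haX (h ▸ hpX)) hi hj hk hpos e
  simpa using L.sub_mem (hCL _ hpC hpX) haL

/-- Three vertices spanning an empty triangle are an affine basis of the lattice. -/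
theorem exists_affine_coords (h : IsLatticePolygon C X) {u v w : Fin 2 → ℤ} (hu : u ∈ X)
    (hv : v ∈ X) (hw : w ∈ X) (huv : u ≠ v) (huw : u ≠ w) (hvw : v ≠ w)
    (hempty : ∀ p : Fin 2 → ℤ, ∀ i j k : ℤ, 0 ≤ i → 0 ≤ j → 0 ≤ k → 0 < i + j + k →
      (i + j + k) • p = i • u + j • v + k • w → p ∈ X) (z : Fin 2 → ℤ) :
    ∃ r s t : ℤ, r + s + t = 1 ∧ z = r • u + s • v + t • w := by
  have htop := eq_top_of_triangle (AddSubgroup.closure {v - u, w - u}) (v - u) (w - u)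
    (h.cross_ne_zero hu hv hw huv huw hvw)
    (AddSubgroup.subset_closure (by simp)) (AddSubgroup.subset_closure (by simp)) (by
      intro p i j k hi hj hk hpos hp
      have e : (k + i + j) • (p + u) = k • u + i • v + j • w := by
        have : (k + i + j) • p = i • (v - u) + j • (w - u) := by
          rw [← hp]; congr 1; ring
        rw [smul_add, this]; module
      have hpX := hempty (p + u) k i j hk hi hj (by linarith) e
      have : p + u = u ∨ p + u = v ∨ p + u = w := by
        by_contra! hne
        exact h.not_barycentre hpX (h.subset u hu) (h.subset v hv) (h.subset w hw) hne.1.symm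
          hne.2.1.symm hne.2.2.symm hk hi hj (by linarith) e
      rcases this with e | e | e
      · rw [add_eq_right.mp e]
        exact AddSubgroup.zero_mem _
      · rw [eq_sub_of_add_eq e]
        exact AddSubgroup.subset_closure (by simp)
      · rw [eq_sub_of_add_eq e]
        exact AddSubgroup.subset_closure (by simp))
  have hz : z - u ∈ AddSubgroup.closure {v - u, w - u} := htop ▸ AddSubgroup.mem_top _
  obtain ⟨s, t, hst⟩ := AddSubgroup.mem_closure_pair.mp hz
  refine ⟨1 - s - t, s, t, by ring, ?_⟩
  rw [eq_add_of_sub_eq hst.symm]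
  module

/-- A vertex expressed in the affine basis given by three other vertices has exactly one
negative coordinate, and the other two are positive. -/
theorem coords_sign (h : IsLatticePolygon C X) {u v w z : Fin 2 → ℤ} (hu : u ∈ X)
    (hv : v ∈ X) (hw : w ∈ X) (hz : z ∈ X) (huv : u ≠ v) (huw : u ≠ w) (hvw : v ≠ w)
    (hzu : z ≠ u) (hzv : z ≠ v) (hzw : z ≠ w) {r s t : ℤ} (h1 : r + s + t = 1)
    (he : z = r • u + s • v + t • w) :
    (r < 0 ∧ 0 < s ∧ 0 < t) ∨ (s < 0 ∧ 0 < r ∧ 0 < t) ∨ (t < 0 ∧ 0 < r ∧ 0 < s) := by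
  have hu' := h.subset u hu
  have hv' := h.subset v hv
  have hw' := h.subset w hw
  have hz' := h.subset z hz
  have hpos : ¬ (0 ≤ r ∧ 0 ≤ s ∧ 0 ≤ t) := fun ⟨hr, hs, ht⟩ ↦
    h.not_barycentre hz hu' hv' hw' hzu.symm hzv.symm hzw.symm hr hs ht (by linarith)
      (by rw [h1, one_smul]; exact he)
  have hcu : ¬ (s ≤ 0 ∧ t ≤ 0) := fun ⟨hs, ht⟩ ↦
    h.not_barycentre (i := 1) (j := -s) (k := -t) hu hz' hv' hw' hzu huv.symm huw.symm
      (by norm_num) (by linarith) (by linarith) (by linarith)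
      (by rw [he, show r = 1 - s - t by linarith]; module)
  have hcv : ¬ (r ≤ 0 ∧ t ≤ 0) := fun ⟨hr, ht⟩ ↦
    h.not_barycentre (i := 1) (j := -r) (k := -t) hv hz' hu' hw' hzv huv hvw.symm
      (by norm_num) (by linarith) (by linarith) (by linarith)
      (by rw [he, show s = 1 - r - t by linarith]; module)
  have hcw : ¬ (r ≤ 0 ∧ s ≤ 0) := fun ⟨hr, hs⟩ ↦
    h.not_barycentre (i := 1) (j := -r) (k := -s) hw hz' hu' hv' hzw huw hvw
      (by norm_num) (by linarith) (by linarith) (by linarith)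
      (by rw [he, show t = 1 - r - s by linarith]; module)
  omega

/-- If `u, v, w` and the fourth parallelogram vertex `v + w - u` are vertices and `u, v, w` is
an affine basis of the lattice, then there is no further vertex. -/
theorem eq_of_parallelogram (h : IsLatticePolygon C X) {u v w y : Fin 2 → ℤ} (hu : u ∈ X)
    (hv : v ∈ X) (hw : w ∈ X) (huv : u ≠ v) (huw : u ≠ w) (hvw : v ≠ w)
    (hq : v + w - u ∈ X) (hy : y ∈ X) (hyu : y ≠ u) (hyv : y ≠ v) (hyw : y ≠ w)
    {r s t : ℤ} (h1 : r + s + t = 1) (he : y = r • u + s • v + t • w) : y = v + w - u := by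
  by_contra hyq
  have hqv : v + w - u ≠ v := fun e ↦ huw (by
    rw [add_sub_assoc, add_eq_left, sub_eq_zero] at e; exact e.symm)
  have hqw : v + w - u ≠ w := fun e ↦ huv (by
    rw [add_comm, add_sub_assoc, add_eq_left, sub_eq_zero] at e; exact e.symm)
  have hu' := h.subset u hu
  have hv' := h.subset v hv
  have hw' := h.subset w hw
  have hy' := h.subset y hy
  have hq' := h.subset _ hq
  obtain rfl : r = 1 - s - t := by linarith
  rcases h.coords_sign hu hv hw hy huv huw hvw hyu hyv hyw h1 he with
    ⟨a, b, c⟩ | ⟨a, b, c⟩ | ⟨a, b, c⟩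
  · refine h.not_barycentre (i := 1) (j := t - 1) (k := s - 1) hq hy' hv' hw' hyq
      hqv.symm hqw.symm (by norm_num) (by linarith) (by linarith) (by linarith) ?_
    rw [he]; module
  · refine h.not_barycentre (i := 1) (j := t - 1) (k := -s) hw hy' hu' hq' hyw huw hqw
      (by norm_num) (by linarith) (by linarith) (by linarith) ?_
    rw [he]; module
  · refine h.not_barycentre (i := 1) (j := s - 1) (k := -t) hv hy' hu' hq' hyv huv hqv
      (by norm_num) (by linarith) (by linarith) (by linarith) ?_
    rw [he]; module

/-- If the functional `g` is constantly `γ` on the non-vertices and larger on an empty triangle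
`u, v, w` of vertices, then it is smaller than `γ` at a vertex facing the edge `v w`. -/
theorem apply_neg_of_opposite (h : IsLatticePolygon C X) (hX : 5 ≤ X.card)
    (g : (Fin 2 → ℤ) →+ ℤ) (γ : ℤ) (hg : ∀ p ∈ C, p ∉ X → g p = γ)
    {u v w z : Fin 2 → ℤ} (hu : u ∈ X)
    (hv : v ∈ X) (hw : w ∈ X) (hz : z ∈ X) (huv : u ≠ v) (huw : u ≠ w) (hvw : v ≠ w)
    (hbasis : ∀ y : Fin 2 → ℤ, ∃ r s t : ℤ, r + s + t = 1 ∧ y = r • u + s • v + t • w)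
    (hgv : γ < g v) (hgw : γ < g w) {r s t : ℤ} (h1 : r + s + t = 1)
    (he : z = r • u + s • v + t • w) (hr : r < 0) (hs : 0 < s) (ht : 0 < t) : g z < γ := by
  have hqC : v + w - u ∈ C := by
    refine h.convex z (h.subset z hz) v (h.subset v hv) w (h.subset w hw) 1 (t - 1) (s - 1)
      (by norm_num) (by linarith) (by linarith) (by linarith) _ ?_
    rw [he, show r = 1 - s - t by linarith]
    module
  by_cases hq : v + w - u ∈ X
  · exfalso
    have hcard : ({u, v, w, v + w - u} : Finset (Fin 2 → ℤ)).card < X.card :=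
      Finset.card_le_four.trans_lt hX
    obtain ⟨y, hy, hyn⟩ := Finset.exists_mem_notMem_of_card_lt_card hcard
    simp only [Finset.mem_insert, Finset.mem_singleton, not_or] at hyn
    obtain ⟨r', s', t', h1', he'⟩ := hbasis y
    exact hyn.2.2.2 (h.eq_of_parallelogram hu hv hw huv huw hvw hq hy hyn.1 hyn.2.1 hyn.2.2.1
      h1' he')
  · have hgq := hg _ hqC hq
    have hne : ¬ (s = 1 ∧ t = 1) := by
      rintro ⟨rfl, rfl⟩
      obtain rfl : r = -1 := by linarith
      apply hq
      rwa [show v + w - u = z by rw [he]; module]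
    rw [map_sub, map_add] at hgq
    rw [he]
    simp only [map_add, map_zsmul, smul_eq_mul]
    have hgu : g u = g v + g w - γ := by linarith
    obtain rfl : r = 1 - s - t := by linarith
    rw [hgu]
    have hst : 1 < s ∨ 1 < t := by omega
    rcases hst with h2 | h2 <;> nlinarith

/-- A line containing all non-vertices which has three vertices strictly on one side has all other
vertices strictly on the other side. -/
theorem apply_neg (h : IsLatticePolygon C X) (hX : 5 ≤ X.card)
    (g : (Fin 2 → ℤ) →+ ℤ) (γ : ℤ) (hg : ∀ p ∈ C, p ∉ X → g p = γ)
    {u v w z : Fin 2 → ℤ} (hu : u ∈ X)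
    (hv : v ∈ X) (hw : w ∈ X) (hz : z ∈ X) (huv : u ≠ v) (huw : u ≠ w) (hvw : v ≠ w)
    (hzu : z ≠ u) (hzv : z ≠ v) (hzw : z ≠ w)
    (hgu : γ < g u) (hgv : γ < g v) (hgw : γ < g w) : g z < γ := by
  have hbasis := h.exists_affine_coords hu hv hw huv huw hvw (by
    intro p i j k hi hj hk hpos hp
    by_contra hpX
    have hgp := hg p (h.convex u (h.subset u hu) v (h.subset v hv) w (h.subset w hw) i j k
      hi hj hk hpos p hp) hpX
    have e := congrArg g hp
    simp only [map_add, map_zsmul, smul_eq_mul, hgp] at e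
    have : i = 0 ∧ j = 0 ∧ k = 0 := by
      refine ⟨?_, ?_, ?_⟩ <;> nlinarith [mul_nonneg hi (sub_nonneg.mpr hgu.le),
        mul_nonneg hj (sub_nonneg.mpr hgv.le), mul_nonneg hk (sub_nonneg.mpr hgw.le)]
    omega)
  obtain ⟨r, s, t, h1, he⟩ := hbasis z
  rcases h.coords_sign hu hv hw hz huv huw hvw hzu hzv hzw h1 he with
    ⟨a, b, c⟩ | ⟨a, b, c⟩ | ⟨a, b, c⟩
  · exact h.apply_neg_of_opposite hX g γ hg hu hv hw hz huv huw hvw hbasis hgv hgw h1 he a b c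
  · refine h.apply_neg_of_opposite (r := s) (s := r) (t := t) hX g γ hg hv hu hw hz huv.symm hvw
      huw (fun y ↦ ?_) hgu hgw (by linarith) (by rw [he]; module) a b c
    obtain ⟨r, s, t, h1, he⟩ := hbasis y
    exact ⟨s, r, t, by linarith, by rw [he]; module⟩
  · refine h.apply_neg_of_opposite (r := t) (s := r) (t := s) hX g γ hg hw hu hv hz huw.symm
      hvw.symm huv (fun y ↦ ?_) hgu hgv (by linarith) (by rw [he]; module) a b c
    obtain ⟨r, s, t, h1, he⟩ := hbasis y
    exact ⟨t, r, s, by linarith, by rw [he]; module⟩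

theorem card_filter_lt_le_two (h : IsLatticePolygon C X) (hX : 7 ≤ X.card)
    (g : (Fin 2 → ℤ) →+ ℤ) (γ : ℤ) (hg : ∀ p ∈ C, p ∉ X → g p = γ) :
    (X.filter (fun x ↦ γ < g x)).card ≤ 2 := by
  by_contra! hcard
  obtain ⟨A, hA, hA3⟩ := Finset.exists_subset_card_eq hcard
  obtain ⟨u, v, w, huv, huw, hvw, rfl⟩ := Finset.card_eq_three.mp hA3
  have hmem : ∀ x ∈ ({u, v, w} : Finset (Fin 2 → ℤ)), x ∈ X ∧ γ < g x := fun x hx ↦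
    Finset.mem_filter.mp (hA hx)
  have hu := hmem u (by simp)
  have hv := hmem v (by simp)
  have hw := hmem w (by simp)
  have hneg : ∀ z ∈ X \ {u, v, w}, z ∈ X ∧ g z < γ := by
    intro z hz
    simp only [Finset.mem_sdiff, Finset.mem_insert, Finset.mem_singleton, not_or] at hz
    exact ⟨hz.1, h.apply_neg (by linarith) g γ hg hu.1 hv.1 hw.1 hz.1 huv huw hvw hz.2.1 hz.2.2.1
      hz.2.2.2 hu.2 hv.2 hw.2⟩
  have h4 : 3 < (X \ {u, v, w}).card := by
    have := Finset.le_card_sdiff {u, v, w} X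
    omega
  obtain ⟨B, hB, hB3⟩ := Finset.exists_subset_card_eq h4.le
  obtain ⟨z, hz, hzB⟩ := Finset.exists_mem_notMem_of_card_lt_card (hB3.trans_lt h4)
  obtain ⟨a, b, c, hab, hac, hbc, rfl⟩ := Finset.card_eq_three.mp hB3
  simp only [Finset.mem_insert, Finset.mem_singleton, not_or] at hzB
  have ha := hneg a (hB (by simp))
  have hb := hneg b (hB (by simp))
  have hc := hneg c (hB (by simp))
  have hz' := hneg z hz
  have := h.apply_neg (by linarith) (-g) (-γ)
    (fun p hp hpX ↦ by simp [hg p hp hpX]) ha.1 hb.1 hc.1 hz'.1 hab hac hbc hzB.1 hzB.2.1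
    hzB.2.2 (by simpa using ha.2) (by simpa using hb.2) (by simpa using hc.2)
  simp only [AddMonoidHom.neg_apply] at this
  linarith [hz'.2]

/-- The functional `p ↦ cross d p`. -/
def crossHom (d : Fin 2 → ℤ) : (Fin 2 → ℤ) →+ ℤ where
  toFun p := cross d p
  map_zero' := by simp [cross]
  map_add' p q := by simp [cross]; ring

theorem crossHom_apply (d p : Fin 2 → ℤ) : crossHom d p = d 0 * p 1 - d 1 * p 0 := rfl

/-- The non-vertices lie on a line. -/
theorem exists_line (h : IsLatticePolygon C X) {L : AddSubgroup (Fin 2 → ℤ)} (hL : L ≠ ⊤)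
    (hCL : ∀ p ∈ C, p ∉ X → p ∈ L) :
    ∃ d : Fin 2 → ℤ, d ≠ 0 ∧ ∃ γ : ℤ, ∀ p ∈ C, p ∉ X → crossHom d p = γ := by
  by_cases hex : ∃ a ∈ C, a ∉ X ∧ ∃ b ∈ C, b ∉ X ∧ a ≠ b
  · obtain ⟨a, ha, haX, b, hb, hbX, hab⟩ := hex
    refine ⟨b - a, sub_ne_zero.mpr hab.symm, crossHom (b - a) a, fun p hp hpX ↦ ?_⟩
    have := h.cross_eq_zero hL hCL ha hb hp haX hbX hpX
    rw [← sub_eq_zero, ← map_sub]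
    exact this
  · push Not at hex
    refine ⟨fun _ ↦ 1, fun h ↦ by simpa using congrFun h 0, ?_⟩
    by_cases hex' : ∃ a ∈ C, a ∉ X
    · obtain ⟨a, ha, haX⟩ := hex'
      exact ⟨_, fun p hp hpX ↦ congrArg _ (hex a ha haX p hp hpX).symm⟩
    · push Not at hex'
      exact ⟨0, fun p hp hpX ↦ absurd (hex' p hp) hpX⟩

theorem card_filter_eq_le_two (h : IsLatticePolygon C X) {d : Fin 2 → ℤ} (hd : d ≠ 0) (γ : ℤ) :
    (X.filter (fun x ↦ crossHom d x = γ)).card ≤ 2 := by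
  by_contra! hcard
  obtain ⟨A, hA, hA3⟩ := Finset.exists_subset_card_eq hcard
  obtain ⟨u, v, w, huv, huw, hvw, rfl⟩ := Finset.card_eq_three.mp hA3
  have hmem : ∀ x ∈ ({u, v, w} : Finset (Fin 2 → ℤ)), x ∈ X ∧ crossHom d x = γ := fun x hx ↦
    Finset.mem_filter.mp (hA hx)
  have hu := hmem u (by simp)
  have hv := hmem v (by simp)
  have hw := hmem w (by simp)
  have h0 := h.cross_ne_zero hu.1 hv.1 hw.1 huv huw hvw
  have hu2 := hu.2
  have hv2 := hv.2
  have hw2 := hw.2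
  simp only [crossHom_apply] at hu2 hv2 hw2
  simp only [cross, Pi.sub_apply] at h0
  apply hd
  ext e
  fin_cases e
  · refine (mul_eq_zero.mp ?_).resolve_right h0
    simp only [Fin.zero_eta]
    linear_combination (v 0 - u 0) * (hw2 - hu2) - (w 0 - u 0) * (hv2 - hu2)
  · refine (mul_eq_zero.mp ?_).resolve_right h0
    simp only [Fin.mk_one]
    linear_combination (v 1 - u 1) * (hw2 - hu2) - (w 1 - u 1) * (hv2 - hu2)

theorem card_le_six (h : IsLatticePolygon C X) {L : AddSubgroup (Fin 2 → ℤ)} (hL : L ≠ ⊤)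
    (hCL : ∀ p ∈ C, p ∉ X → p ∈ L) : X.card ≤ 6 := by
  by_contra! hX
  obtain ⟨d, hd, γ, hγ⟩ := h.exists_line hL hCL
  have h1 := h.card_filter_lt_le_two hX (crossHom d) γ hγ
  have h2 := h.card_filter_lt_le_two hX (-crossHom d) (-γ) (fun p hp hpX ↦ by simp [hγ p hp hpX])
  have h3 := h.card_filter_eq_le_two hd γ
  have hsub : X ⊆ (X.filter (fun x ↦ γ < crossHom d x) ∪
      X.filter (fun x ↦ -γ < (-crossHom d) x)) ∪ X.filter (fun x ↦ crossHom d x = γ) := by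
    intro x hx
    rcases lt_trichotomy (crossHom d x) γ with hlt | heq | hgt
    · simp [hx, hlt]
    · simp [hx, heq]
    · simp [hx, hgt]
  have h4 := Finset.card_le_card hsub
  have h5 := h4.trans (Finset.card_union_le _ _)
  have h6 := Finset.card_union_le (X.filter (fun x ↦ γ < crossHom d x))
    (X.filter (fun x ↦ -γ < (-crossHom d) x))
  omega

end IsLatticePolygon

/-- If finitely many half-spaces `a i < b i` have no common point in the finite set `T`, then
some inclusion-minimal subfamily can be relaxed until each boundary hyperplane carries a point
of `T` lying in all the other open half-spaces. -/
theorem exists_tight_halfspaces {E J : Type*} (T : Finset E) (A : Finset J) (a : J → E → ℝ)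
    (b : J → ℝ) (hcover : ∀ t ∈ T, ∃ i ∈ A, b i ≤ a i t) :
    ∃ B ⊆ A, (∀ t ∈ T, ∃ i ∈ B, b i ≤ a i t) ∧ ∃ b' : J → ℝ,
      (∀ t ∈ T, ∃ i ∈ B, b' i ≤ a i t) ∧
      ∀ i ∈ B, ∃ t ∈ T, a i t = b' i ∧ ∀ j ∈ B, j ≠ i → a j t < b' j := by
  classical
  obtain ⟨B, hBA, hB⟩ := exists_minimal_le_of_wellFoundedLT
    (fun B : Finset J ↦ ∀ t ∈ T, ∃ i ∈ B, b i ≤ a i t) A hcover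
  have hne : ∀ i ∈ B, ∃ t ∈ T, ∀ j ∈ B, j ≠ i → a j t < b j := by
    intro i hi
    by_contra! hcon
    refine (Finset.erase_ssubset hi).not_subset (hB.2 (fun t ht ↦ ?_) (Finset.erase_subset i B))
    obtain ⟨j, hj, hji, hle⟩ := hcon t ht
    exact ⟨j, Finset.mem_erase.mpr ⟨hji, hj⟩, hle⟩
  refine ⟨B, hBA, hB.1, ?_⟩
  suffices key : ∀ s : Finset J, s ⊆ B → ∃ b' : J → ℝ, (∀ t ∈ T, ∃ i ∈ B, b' i ≤ a i t) ∧
      (∀ i ∈ B, ∃ t ∈ T, ∀ j ∈ B, j ≠ i → a j t < b' j) ∧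
      ∀ i ∈ s, ∃ t ∈ T, a i t = b' i ∧ ∀ j ∈ B, j ≠ i → a j t < b' j by
    obtain ⟨b', h1, -, h2⟩ := key B subset_rfl
    exact ⟨b', h1, h2⟩
  intro s
  induction s using Finset.induction_on with
  | empty => exact fun _ ↦ ⟨b, hB.1, hne, by simp⟩
  | insert i s his ih =>
    intro hs
    obtain ⟨b', h1, h2, h3⟩ := ih fun j hj ↦ hs (Finset.mem_insert_of_mem hj)
    have hiB : i ∈ B := hs (Finset.mem_insert_self i s)
    obtain ⟨t₀, ht₀, ht₀'⟩ := h2 i hiB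
    obtain ⟨x, hx, hmin⟩ := (T.filter fun t ↦ ∀ j ∈ B, j ≠ i → a j t < b' j).exists_min_image
      (a i) ⟨t₀, Finset.mem_filter.mpr ⟨ht₀, ht₀'⟩⟩
    obtain ⟨hxT, hx⟩ := Finset.mem_filter.mp hx
    have hle : b' i ≤ a i x := by
      obtain ⟨j, hj, hjle⟩ := h1 x hxT
      by_cases hji : j = i
      · exact hji ▸ hjle
      · exact absurd hjle (hx j hj hji).not_ge
    have hmono : b' ≤ Function.update b' i (a i x) := by
      intro j
      by_cases hji : j = i
      · subst hji; simpa using hle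
      · simp [hji]
    refine ⟨Function.update b' i (a i x), fun t ht ↦ ?_, fun j hj ↦ ?_, fun j hj ↦ ?_⟩
    · by_cases htm : ∀ j ∈ B, j ≠ i → a j t < b' j
      · exact ⟨i, hiB, by simpa using hmin t (Finset.mem_filter.mpr ⟨ht, htm⟩)⟩
      · push Not at htm
        obtain ⟨j, hj, hji, hjle⟩ := htm
        exact ⟨j, hj, by simpa [hji] using hjle⟩
    · obtain ⟨t, ht, h⟩ := h2 j hj
      exact ⟨t, ht, fun k hk hkj ↦ (h k hk hkj).trans_le (hmono k)⟩
    · by_cases hji : j = i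
      · subst hji
        exact ⟨x, hxT, by simp, fun k hk hkj ↦ (hx k hk hkj).trans_le (hmono k)⟩
      · obtain ⟨t, ht, h, h'⟩ := h3 j (Finset.mem_of_mem_insert_of_ne hj hji)
        exact ⟨t, ht, by simp [hji, h], fun k hk hkj ↦ (h' k hk hkj).trans_le (hmono k)⟩

/-- **Hoffman's bound**: the Helly number of a discrete set `S` is at most the maximal number
of vertices of a polytope with vertices in `S` and no further points of `S`. -/
theorem hellyLe_of_card_le {d : ℕ} {S : Set (EuclideanSpace ℝ (Fin d))} {n : ℕ}
    (hfin : ∀ W : Set (EuclideanSpace ℝ (Fin d)), W.Finite → (S ∩ convexHull ℝ W).Finite)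
    (h : ∀ X : Finset (EuclideanSpace ℝ (Fin d)), (X : Set _) ⊆ S →
      S ∩ convexHull ℝ X ⊆ X →
      (∀ x ∈ X, ∃ f : StrongDual ℝ (EuclideanSpace ℝ (Fin d)),
        ∀ y ∈ convexHull ℝ (X : Set _), y ≠ x → f y < f x) → X.card ≤ n) :
    HellyLe S n := by
  classical
  intro m F hF hI
  by_contra hempty
  choose! w hw using hI
  set W : Set (EuclideanSpace ℝ (Fin d)) := w '' {I | I.card ≤ n}
  have hWfin : W.Finite := Set.toFinite _
  set T := (hfin W hWfin).toFinset
  set K : Fin m → Set (EuclideanSpace ℝ (Fin d)) :=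
    fun i ↦ convexHull ℝ (w '' {I | I.card ≤ n ∧ i ∈ I})
  have hKF : ∀ i, K i ⊆ F i := fun i ↦ convexHull_min (by
    rintro _ ⟨I, ⟨hI, hi⟩, rfl⟩
    exact Set.mem_iInter₂.mp (hw I hI).2 i hi) (hF i)
  have hsep : ∀ q : Fin m × EuclideanSpace ℝ (Fin d), q.2 ∉ K q.1 →
      ∃ (f : StrongDual ℝ (EuclideanSpace ℝ (Fin d))) (u : ℝ),
        (∀ y ∈ K q.1, f y < u) ∧ u < f q.2 := fun q hq ↦
    geometric_hahn_banach_closed_point (convex_convexHull ℝ _)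
      ((Set.toFinite _).isClosed_convexHull ℝ) hq
  choose! f u hfu hu using hsep
  obtain ⟨B, hBA, hB, b', hb', hx⟩ := exists_tight_halfspaces T
    (((Finset.univ : Finset (Fin m)) ×ˢ T).filter fun q ↦ q.2 ∉ K q.1) (fun q y ↦ f q y) u (by
      intro t ht
      have htS : t ∈ S := ((Set.Finite.mem_toFinset _).mp ht).1
      have : ∃ i, t ∉ F i := by
        by_contra! hcon
        exact hempty ⟨t, htS, Set.mem_iInter.mpr hcon⟩
      obtain ⟨i, hi⟩ := this
      have hiK : t ∉ K i := fun h ↦ hi (hKF i h)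
      exact ⟨(i, t), by simp [ht, hiK], (hu (i, t) hiK).le⟩)
  choose! x hxT hxb hx using hx
  have hmemT : ∀ t, t ∈ T ↔ t ∈ S ∩ convexHull ℝ W := fun t ↦ Set.Finite.mem_toFinset _
  have hinj : Set.InjOn x B := by
    intro i hi j hj hij
    by_contra hne
    have := hx i hi j hj (Ne.symm hne)
    rw [hij, hxb j hj] at this
    exact lt_irrefl _ this
  have hexp : ∀ i ∈ B, ∀ y ∈ convexHull ℝ (B.image x : Set (EuclideanSpace ℝ (Fin d))),
      y ≠ x i → f i y < b' i := by
    intro i hi y hy hne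
    have hconv : Convex ℝ {z | f i z < b' i ∨ z = x i} := by
      rw [convex_iff_forall_pos]
      have hle : ∀ z, (f i z < b' i ∨ z = x i) → f i z ≤ b' i := by
        rintro z (hz | rfl)
        · exact hz.le
        · exact (hxb i hi).le
      rintro z hz z' hz' α β hα hβ hαβ
      simp only [Set.mem_ofPred_eq, map_add, map_smul, smul_eq_mul]
      have hsum : b' i = α * b' i + β * b' i := by rw [← add_mul, hαβ, one_mul]
      have e1 := mul_le_mul_of_nonneg_left (hle z hz) hα.le
      have e2 := mul_le_mul_of_nonneg_left (hle z' hz') hβ.le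
      rcases hz with hz | rfl
      · left
        linarith [mul_lt_mul_of_pos_left hz hα]
      · rcases hz' with hz' | rfl
        · left
          linarith [mul_lt_mul_of_pos_left hz' hβ]
        · right
          rw [← add_smul, hαβ, one_smul]
    refine (convexHull_min ?_ hconv hy).resolve_right hne
    intro z hz
    obtain ⟨j, hj, rfl⟩ := Finset.mem_image.mp (Finset.mem_coe.mp hz)
    by_cases hji : j = i
    · exact Or.inr (by rw [hji])
    · exact Or.inl (hx j hj i hi (Ne.symm hji))
  have hXT : ((B.image x : Finset _) : Set (EuclideanSpace ℝ (Fin d))) ⊆ S ∩ convexHull ℝ W := by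
    intro z hz
    obtain ⟨j, hj, rfl⟩ := Finset.mem_image.mp (Finset.mem_coe.mp hz)
    exact (hmemT _).mp (hxT j hj)
  have hcard : B.card ≤ n := by
    rw [← Finset.card_image_of_injOn hinj]
    refine h _ (fun z hz ↦ (hXT hz).1) ?_ ?_
    · rintro y ⟨hyS, hy⟩
      have hyT : y ∈ T := (hmemT y).mpr
        ⟨hyS, convexHull_min (fun z hz ↦ (hXT hz).2) (convex_convexHull ℝ W) hy⟩
      obtain ⟨i, hi, hle⟩ := hb' y hyT
      by_contra hyX
      refine (hexp i hi y hy ?_).not_ge hle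
      rintro rfl
      exact hyX (Finset.mem_coe.mpr (Finset.mem_image_of_mem x hi))
    · intro z hz
      obtain ⟨i, hi, rfl⟩ := Finset.mem_image.mp hz
      exact ⟨f i, fun y hy hne ↦ hxb i hi ▸ hexp i hi y hy hne⟩
  have hIcard : (B.image Prod.fst).card ≤ n := Finset.card_image_le.trans hcard
  have hwT : w (B.image Prod.fst) ∈ T :=
    (hmemT _).mpr ⟨(hw _ hIcard).1, subset_convexHull ℝ W ⟨_, hIcard, rfl⟩⟩
  obtain ⟨q, hq, hle⟩ := hB _ hwT
  have hwK : w (B.image Prod.fst) ∈ K q.1 :=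
    subset_convexHull ℝ _ ⟨_, ⟨hIcard, Finset.mem_image_of_mem _ hq⟩, rfl⟩
  exact (hfu q (Finset.mem_filter.mp (hBA hq)).2 _ hwK).not_ge hle

/-- The embedding of `ℤ²` in the Euclidean plane. -/
noncomputable def latticeEmb : (Fin 2 → ℤ) →+ EuclideanSpace ℝ (Fin 2) where
  toFun p := WithLp.toLp 2 fun i ↦ (p i : ℝ)
  map_zero' := by ext i; simp
  map_add' p q := by ext i; simp

theorem latticeEmb_apply (p : Fin 2 → ℤ) (i : Fin 2) : latticeEmb p i = p i := rfl

theorem latticeEmb_injective : Function.Injective latticeEmb := fun p q h ↦ by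
  ext i
  have := congrArg (fun x : EuclideanSpace ℝ (Fin 2) ↦ x i) h
  simpa [latticeEmb_apply] using this

theorem finite_preimage_latticeEmb {B : Set (EuclideanSpace ℝ (Fin 2))}
    (hB : Bornology.IsBounded B) : (latticeEmb ⁻¹' B).Finite := by
  obtain ⟨R, hR⟩ := hB.exists_norm_le
  refine (Set.finite_Icc (fun _ ↦ -⌈R⌉ : Fin 2 → ℤ) (fun _ ↦ ⌈R⌉)).subset fun p hp ↦ ?_
  have hb : ∀ i, |p i| ≤ ⌈R⌉ := fun i ↦ by
    have h1 := (PiLp.norm_apply_le (latticeEmb p) i).trans (hR _ hp)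
    rw [latticeEmb_apply, Real.norm_eq_abs] at h1
    exact_mod_cast h1.trans (Int.le_ceil R)
  exact ⟨fun i ↦ (abs_le.mp (hb i)).1, fun i ↦ (abs_le.mp (hb i)).2⟩

theorem mem_of_zsmul_eq {K : Set (EuclideanSpace ℝ (Fin 2))} (hK : Convex ℝ K)
    {a b c p : Fin 2 → ℤ} (ha : latticeEmb a ∈ K) (hb : latticeEmb b ∈ K)
    (hc : latticeEmb c ∈ K) {i j k : ℤ} (hi : 0 ≤ i) (hj : 0 ≤ j) (hk : 0 ≤ k)
    (hpos : 0 < i + j + k) (hp : (i + j + k) • p = i • a + j • b + k • c) :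
    latticeEmb p ∈ K := by
  have hpos' : (0 : ℝ) < i + j + k := by exact_mod_cast hpos
  have hi' : (0 : ℝ) ≤ i := by exact_mod_cast hi
  have hj' : (0 : ℝ) ≤ j := by exact_mod_cast hj
  have hk' : (0 : ℝ) ≤ k := by exact_mod_cast hk
  have hmem := hK.sum_mem (t := Finset.univ)
    (w := ![(i : ℝ) / (i + j + k), (j : ℝ) / (i + j + k), (k : ℝ) / (i + j + k)])
    (z := ![latticeEmb a, latticeEmb b, latticeEmb c])
    (by intro e _; fin_cases e <;> simp <;> positivity)
    (by simp [Fin.sum_univ_three]; field_simp)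
    (by intro e _; fin_cases e <;> simpa)
  convert hmem using 1
  ext e
  have he := congrFun hp e
  simp only [Pi.smul_apply, Pi.add_apply, smul_eq_mul] at he
  have he' : ((i : ℝ) + j + k) * p e = i * a e + j * b e + k * c e := by exact_mod_cast he
  simp [Fin.sum_univ_three, latticeEmb_apply]
  field_simp
  linarith

/-- If `L` is a proper sublattice (additive subgroup) of `ℤ²` and `S = ℤ² \ L`
(viewed inside `ℝ²`), then `h(S) ≤ 6`. -/
theorem helly_lattice_diff (L : AddSubgroup (Fin 2 → ℤ)) (hL : L ≠ ⊤) :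
    HellyLe {x : EuclideanSpace ℝ (Fin 2) |
      ∃ p : Fin 2 → ℤ, (∀ i, x i = (p i : ℝ)) ∧ p ∉ L} 6 := by
  have hS : {x : EuclideanSpace ℝ (Fin 2) | ∃ p : Fin 2 → ℤ, (∀ i, x i = (p i : ℝ)) ∧ p ∉ L} =
      latticeEmb '' (L : Set (Fin 2 → ℤ))ᶜ := by
    ext x
    constructor
    · rintro ⟨p, hp, hpL⟩
      exact ⟨p, hpL, by ext i; rw [latticeEmb_apply, hp]⟩
    · rintro ⟨p, hpL, rfl⟩
      exact ⟨p, latticeEmb_apply p, hpL⟩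
  rw [hS]
  refine hellyLe_of_card_le (fun W hW ↦ ?_) fun X hXS hX hexp ↦ ?_
  · refine ((finite_preimage_latticeEmb
      (hW.isCompact_convexHull ℝ).isBounded).image latticeEmb).subset ?_
    rintro _ ⟨⟨p, -, rfl⟩, hp⟩
    exact ⟨p, hp, rfl⟩
  · set Y := X.preimage latticeEmb latticeEmb_injective.injOn
    have hY : ∀ p, p ∈ Y ↔ latticeEmb p ∈ X := fun p ↦ Finset.mem_preimage
    have hpoly : IsLatticePolygon (latticeEmb ⁻¹' convexHull ℝ (X : Set _)) Y :=
      { subset := fun x hx ↦ subset_convexHull ℝ _ ((hY x).mp hx)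
        convex := fun a ha b hb c hc i j k hi hj hk hpos p hp ↦
          mem_of_zsmul_eq (convex_convexHull ℝ _) ha hb hc hi hj hk hpos hp
        exposed := fun x hx ↦ by
          obtain ⟨f, hf⟩ := hexp _ ((hY x).mp hx)
          exact ⟨(f : EuclideanSpace ℝ (Fin 2) →+ ℝ).comp latticeEmb,
            fun y hy hne ↦ hf _ hy (latticeEmb_injective.ne hne)⟩ }
    have hcard : Y.card = X.card := by
      classical
      rw [Finset.card_preimage, Finset.filter_true_of_mem]
      intro x hx
      obtain ⟨p, -, hp⟩ := hXS hx
      exact ⟨p, hp⟩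
    rw [← hcard]
    refine hpoly.card_le_six hL fun p hp hpY ↦ ?_
    by_contra hpL
    exact hpY ((hY p).mpr (hX ⟨⟨p, hpL, rfl⟩, hp⟩))
end

section
/- There exist a proper additive subgroup L of ℤ² (L ≠ ℤ²) and six convex subsets K₁, …, K₆ of ℝ² such that any five of the sets have a common point belonging to S = ℤ² \ L, but the intersection of all six contains no point of S. Hence h(ℤ² \ L) ≥ 6 for some proper sublattice L, so the bound 6 is sharp. -/
/-- The set `ℤ² \ L` viewed inside `ℝ²`, for an additive subgroup `L` of `ℤ²`. -/
def latticeDiff (L : AddSubgroup (Fin 2 → ℤ)) : Set (EuclideanSpace ℝ (Fin 2)) :=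
  {x | ∃ p : Fin 2 → ℤ, (∀ i, x i = (p i : ℝ)) ∧ p ∉ L}

/-- Vertices, in cyclic order, of a hexagon whose only other lattice point is the origin. -/
def hexVertex : Fin 6 → Fin 2 → ℤ :=
  ![![1, 0], ![1, 1], ![0, 1], ![-1, 0], ![-1, -1], ![0, -1]]

/-- Linear functionals; the `i`-th one attains its maximum `2` over the hexagon exactly at the
`i`-th vertex. -/
def hexNormal : Fin 6 → Fin 2 → ℤ :=
  ![![2, -1], ![1, 1], ![-1, 2], ![-2, 1], ![-1, -1], ![1, -2]]

/-- The open half-plane cutting off exactly the `i`-th vertex of the hexagon. -/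
def hexHalfPlane (i : Fin 6) : Set (EuclideanSpace ℝ (Fin 2)) :=
  {x | (hexNormal i 0 : ℝ) * x 0 + (hexNormal i 1 : ℝ) * x 1 < 2}

theorem convex_hexHalfPlane (i : Fin 6) : Convex ℝ (hexHalfPlane i) := by
  refine convex_halfSpace_lt (f := fun x : EuclideanSpace ℝ (Fin 2) =>
    (hexNormal i 0 : ℝ) * x 0 + (hexNormal i 1 : ℝ) * x 1) ⟨fun x y => ?_, fun c x => ?_⟩ 2
  · simp only [PiLp.add_apply]
    ring
  · simp only [PiLp.smul_apply, smul_eq_mul]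
    ring

theorem mem_hexHalfPlane_iff {x : EuclideanSpace ℝ (Fin 2)} {p : Fin 2 → ℤ}
    (hx : ∀ k, x k = (p k : ℝ)) (i : Fin 6) :
    x ∈ hexHalfPlane i ↔ hexNormal i 0 * p 0 + hexNormal i 1 * p 1 < 2 := by
  simp only [hexHalfPlane, Set.mem_ofPred_eq, hx]
  norm_cast

theorem hexVertex_ne_zero (i : Fin 6) : hexVertex i ≠ 0 := by
  revert i
  decide

theorem hexNormal_hexVertex_lt {i j : Fin 6} (h : j ≠ i) :
    hexNormal j 0 * hexVertex i 0 + hexNormal j 1 * hexVertex i 1 < 2 := by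
  revert i j
  decide

theorem eq_zero_of_forall_hexNormal_lt {p : Fin 2 → ℤ}
    (h : ∀ i, hexNormal i 0 * p 0 + hexNormal i 1 * p 1 < 2) : p = 0 := by
  simp only [Fin.forall_fin_succ, hexNormal] at h
  simp at h
  ext k
  fin_cases k <;> simp <;> omega

theorem latticeDiff_bot_inter_hexHalfPlane_nonempty (i : Fin 6) :
    (latticeDiff ⊥ ∩ ⋂ j ∈ ({i}ᶜ : Finset (Fin 6)), hexHalfPlane j).Nonempty := by
  have hx : ∀ k, (WithLp.toLp 2 fun k => (hexVertex i k : ℝ) : EuclideanSpace ℝ (Fin 2)) k =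
      (hexVertex i k : ℝ) := fun _ => rfl
  refine ⟨_, ⟨hexVertex i, hx, hexVertex_ne_zero i⟩, Set.mem_iInter₂.2 fun j hj => ?_⟩
  exact (mem_hexHalfPlane_iff hx j).2 (hexNormal_hexVertex_lt (by simpa using hj))

theorem latticeDiff_bot_inter_iInter_hexHalfPlane :
    latticeDiff ⊥ ∩ ⋂ i, hexHalfPlane i = ∅ := by
  refine Set.eq_empty_iff_forall_notMem.2 ?_
  rintro x ⟨⟨p, hx, hp⟩, hK⟩
  exact hp (eq_zero_of_forall_hexNormal_lt fun i =>
    (mem_hexHalfPlane_iff hx i).1 (Set.mem_iInter.1 hK i))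

/-- If all but one of `n + 1` convex sets always meet inside `S`, but all of them do not, then the
`S`-Helly number exceeds `n`. -/
theorem not_hellyLe_of_iInter_eq_empty {d n : ℕ} {S : Set (EuclideanSpace ℝ (Fin d))}
    {K : Fin (n + 1) → Set (EuclideanSpace ℝ (Fin d))} (hK : ∀ i, Convex ℝ (K i))
    (hne : ∀ i, (S ∩ ⋂ j ∈ ({i}ᶜ : Finset (Fin (n + 1))), K j).Nonempty)
    (hempty : S ∩ ⋂ i, K i = ∅) : ¬ HellyLe S n := by
  intro h
  refine (h _ K hK fun I hI => ?_).ne_empty hempty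
  obtain ⟨i, hi⟩ : ∃ i, i ∉ I := by
    by_contra! hall
    simp [Finset.eq_univ_iff_forall.2 hall] at hI
  refine (hne i).mono (Set.inter_subset_inter_right S (Set.biInter_mono ?_ fun _ _ => le_rfl))
  intro j hj
  simpa using ne_of_mem_of_not_mem hj hi

/-- There exist a proper sublattice `L` of `ℤ²` and six convex subsets of `ℝ²` such that any
five of them have a common point of `S = ℤ² \ L`, but all six together contain no point of
`S`. Hence `h(ℤ² \ L) ≥ 6` for some proper sublattice `L`, i.e. the bound `6` is sharp. -/
theorem lattice_diff_sharp :
    ∃ L : AddSubgroup (Fin 2 → ℤ), L ≠ ⊤ ∧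
      ∃ K : Fin 6 → Set (EuclideanSpace ℝ (Fin 2)),
        (∀ i, Convex ℝ (K i)) ∧
        (∀ i : Fin 6, (latticeDiff L ∩ ⋂ j ∈ ({i}ᶜ : Finset (Fin 6)), K j).Nonempty) ∧
        (latticeDiff L ∩ ⋂ i, K i) = ∅ ∧
        ¬ HellyLe (latticeDiff L) 5 := by
  exact ⟨⊥, bot_ne_top, hexHalfPlane, convex_hexHalfPlane,
    latticeDiff_bot_inter_hexHalfPlane_nonempty,
    latticeDiff_bot_inter_iInter_hexHalfPlane,
    not_hellyLe_of_iInter_eq_empty convex_hexHalfPlane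
      latticeDiff_bot_inter_hexHalfPlane_nonempty latticeDiff_bot_inter_iInter_hexHalfPlane⟩
end

section
/- For every subset S ⊆ ℝ, h(S) ≤ 2; that is, for every finite nonempty family F₁, …, F_m of convex subsets of ℝ, if every subfamily of at most 2 of the sets has a common point belonging to S (in particular each F_i contains a point of S), then all m sets have a common point belonging to S. -/
/-- Helly's theorem in a linear order, relative to a set `S`: if any two members of a finite
nonempty family of order-connected sets meet within `S`, then all of them meet within `S`. -/
theorem Set.nonempty_inter_iInter_of_ordConnected {ι α : Type*} [Finite ι] [Nonempty ι]
    [LinearOrder α] {S : Set α} {F : ι → Set α} (hF : ∀ i, (F i).OrdConnected)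
    (h : ∀ i j, (S ∩ (F i ∩ F j)).Nonempty) : (S ∩ ⋂ i, F i).Nonempty := by
  choose p hS hl hr using h
  choose b hb using fun i => Finite.exists_max (p i)
  obtain ⟨k, hk⟩ := Finite.exists_min fun i => p i (b i)
  exact ⟨p k (b k), hS _ _, Set.mem_iInter.2 fun i =>
    (hF i).out (hr k i) (hl i (b i)) ⟨hb k i, hk i⟩⟩


/-- For every subset `S ⊆ ℝ`, `h(S) ≤ 2`: for every finite family of convex subsets of `ℝ`,
if every subfamily of at most two of the sets has a common point belonging to `S`, then all
the sets have a common point belonging to `S`. -/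
theorem helly_dim_one (S : Set ℝ) (m : ℕ) (F : Fin m → Set ℝ)
    (hconv : ∀ i, Convex ℝ (F i))
    (hint : ∀ I : Finset (Fin m), I.card ≤ 2 → (S ∩ ⋂ i ∈ I, F i).Nonempty) :
    (S ∩ ⋂ i, F i).Nonempty := by
  cases isEmpty_or_nonempty (Fin m) with
  | inl _ => simpa using hint ∅ (by simp)
  | inr _ =>
    refine Set.nonempty_inter_iInter_of_ordConnected (fun i => (hconv i).ordConnected) ?_
    intro i j
    simpa using hint {i, j} Finset.card_le_two
end

section
/- Let S₁, S₂ ⊆ ℝ^d and let n₁, n₂ ∈ ℕ be such that h(S₁) ≤ n₁ and h(S₂) ≤ n₂. Then h(S₁ ∪ S₂) ≤ n₁ + n₂; that is, for every finite family F₁, …, F_m of convex subsets of ℝ^d, if every subfamily of at most n₁ + n₂ of the sets has a common point belonging to S₁ ∪ S₂, then all m sets have a common point belonging to S₁ ∪ S₂. -/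
/-- If `h(S₁) ≤ n₁` and `h(S₂) ≤ n₂`, then `h(S₁ ∪ S₂) ≤ n₁ + n₂`. -/
theorem helly_union (d : ℕ) (S₁ S₂ : Set (EuclideanSpace ℝ (Fin d))) (n₁ n₂ : ℕ)
    (h₁ : HellyLe S₁ n₁) (h₂ : HellyLe S₂ n₂) :
    HellyLe (S₁ ∪ S₂) (n₁ + n₂) := by
  intro m F hF h
  by_contra hne
  have key : ∀ (S : Set (EuclideanSpace ℝ (Fin d))) (n : ℕ), HellyLe S n → S ⊆ S₁ ∪ S₂ →
      ∃ I : Finset (Fin m), I.card ≤ n ∧ ¬ (S ∩ ⋂ i ∈ I, F i).Nonempty := by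
    intro S n hS hsub
    by_contra! hI
    exact hne ((hS m F hF hI).mono (Set.inter_subset_inter_left _ hsub))
  obtain ⟨I₁, hc₁, hI₁⟩ := key S₁ n₁ h₁ Set.subset_union_left
  obtain ⟨I₂, hc₂, hI₂⟩ := key S₂ n₂ h₂ Set.subset_union_right
  obtain ⟨x, hxS, hxF⟩ := h (I₁ ∪ I₂) ((Finset.card_union_le _ _).trans (by omega))
  simp only [Set.mem_iInter, Finset.mem_union] at hxF
  rcases hxS with hx | hx
  · exact hI₁ ⟨x, hx, Set.mem_iInter₂.2 fun i hi => hxF i (Or.inl hi)⟩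
  · exact hI₂ ⟨x, hx, Set.mem_iInter₂.2 fun i hi => hxF i (Or.inr hi)⟩
end

section
/- Let x₁, …, x_n be n distinct points of ℝ² in strictly convex position (each x_i does not lie in the convex hull of the other n−1 points) and let S = {x₁, …, x_n}. Then h(S) = n. In particular, the n convex sets F_i = conv(S \ {x_i}), i = 1, …, n, are such that any n−1 of them have a common point belonging to S, but the intersection of all n of them contains no point of S; and conversely h(S) ≤ n holds because S has exactly n points. -/
theorem hellyLe_range {d n : ℕ} (x : Fin n → EuclideanSpace ℝ (Fin d)) :
    HellyLe (Set.range x) n := by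
  intro m F _ hF
  by_contra hne
  have hmiss : ∀ i, ∃ k, x i ∉ F k := by
    intro i
    by_contra! hi
    exact hne ⟨x i, ⟨i, rfl⟩, Set.mem_iInter.2 hi⟩
  choose f hf using hmiss
  obtain ⟨_, ⟨i, rfl⟩, hi⟩ := hF (Finset.univ.image f)
    (Finset.card_image_le.trans (Finset.card_fin n).le)
  exact hf i (Set.mem_iInter₂.1 hi (f i) (Finset.mem_image_of_mem f (Finset.mem_univ i)))

theorem range_inter_iInter_convexHull_nonempty {ι E : Type*} [AddCommGroup E] [Module ℝ E]
    (x : ι → E) {I : Finset ι} {i : ι} (hi : i ∉ I) :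
    (Set.range x ∩ ⋂ j ∈ I, convexHull ℝ (x '' {l | l ≠ j})).Nonempty :=
  ⟨x i, ⟨i, rfl⟩, Set.mem_iInter₂.2 fun _ hj =>
    subset_convexHull ℝ _ ⟨i, fun hij => hi (hij ▸ hj), rfl⟩⟩

theorem range_inter_iInter_convexHull_eq_empty {ι E : Type*} [AddCommGroup E] [Module ℝ E]
    (x : ι → E) (hx : ∀ i, x i ∉ convexHull ℝ (x '' {j | j ≠ i})) :
    (Set.range x ∩ ⋂ i, convexHull ℝ (x '' {l | l ≠ i})) = ∅ := by
  rw [Set.eq_empty_iff_forall_notMem]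
  rintro _ ⟨⟨i, rfl⟩, hi⟩
  exact hx i (Set.mem_iInter.1 hi i)


/-- If `S = {x₁, …, x_n}` consists of `n` distinct points of `ℝ²` in strictly convex position,
then `h(S) = n`: the convex sets `F i = conv (S \ {x i})` are such that any `n − 1` of them
have a common point of `S` while all `n` have none (so `h(S) ≤ n − 1` fails), and `h(S) ≤ n`
holds. -/
theorem helly_convex_position (n : ℕ) (hn : 1 ≤ n) (x : Fin n → EuclideanSpace ℝ (Fin 2))
    (hinj : Function.Injective x)
    (hconvpos : ∀ i, x i ∉ convexHull ℝ (x '' {j | j ≠ i})) :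
    HellyLe (Set.range x) n ∧
    (∀ i : Fin n,
      (Set.range x ∩ ⋂ j ∈ ({i}ᶜ : Finset (Fin n)), convexHull ℝ (x '' {l | l ≠ j})).Nonempty) ∧
    (Set.range x ∩ ⋂ i, convexHull ℝ (x '' {l | l ≠ i})) = ∅ ∧
    ¬ HellyLe (Set.range x) (n - 1) := by
  have hempty := range_inter_iInter_convexHull_eq_empty x hconvpos
  refine ⟨hellyLe_range x, fun i => range_inter_iInter_convexHull_nonempty x (i := i) (by simp),
    hempty, fun h => ?_⟩
  refine (h n _ (fun i => convex_convexHull ℝ (x '' {l | l ≠ i})) fun I hI => ?_).ne_empty hempty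
  obtain ⟨i, hi⟩ : ∃ i, i ∉ I := by
    by_contra! hall
    rw [Finset.eq_univ_iff_forall.2 hall, Finset.card_fin] at hI
    omega
  exact range_inter_iInter_convexHull_nonempty x hi
end

section
/- Let S = {x ∈ ℝ² : ‖x‖ = 1} be the unit circle. Then h(S) = ∞: for every n ≥ 3 there exist convex subsets F₁, …, F_n of ℝ² such that any n−1 of them have a common point belonging to S, but the intersection of all n contains no point of S. Hence for no n ∈ ℕ does 'h(S) ≤ n' hold. -/
open Set

theorem mem_of_mem_convexHull_of_subset_sphere {E : Type*} [NormedAddCommGroup E]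
    [NormedSpace ℝ E] [StrictConvexSpace ℝ E] {A : Set E} {c x : E} {r : ℝ}
    (hA : A ⊆ Metric.sphere c r) (hx : x ∈ Metric.sphere c r) (hxA : x ∈ convexHull ℝ A) :
    x ∈ A := by
  have hsub : convexHull ℝ A ⊆ Metric.closedBall c r :=
    convexHull_min (hA.trans Metric.sphere_subset_closedBall) (convex_closedBall c r)
  refine extremePoints_convexHull_subset (𝕜 := ℝ)
    (inter_extremePoints_subset_extremePoints_of_subset hsub ⟨hxA, ?_⟩)
  rw [Metric.mem_sphere] at hx
  refine mem_extremePoints_iff_left.2 ⟨hx.le, fun y hy z hz hyz => ?_⟩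
  by_contra hne
  have hyz' : y ≠ z := by
    rintro rfl
    rw [openSegment_same] at hyz
    exact hne hyz.symm
  exact (Metric.mem_ball.1 (openSegment_subset_ball_of_ne hy hz hyz' hyz)).ne hx

theorem exists_injective_norm_eq_one :
    ∃ p : ℕ → EuclideanSpace ℝ (Fin 2), Function.Injective p ∧ ∀ k, ‖p k‖ = 1 := by
  refine ⟨fun k => !₂[1 / ((k : ℝ) + 1), √(1 - (1 / ((k : ℝ) + 1)) ^ 2)], fun a b h => ?_,
    fun k => ?_⟩
  · have h0 := congrArg (fun v : EuclideanSpace ℝ (Fin 2) => v 0) h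
    simpa using h0
  · have h1 : (1 / ((k : ℝ) + 1)) ^ 2 ≤ 1 := by
      apply pow_le_one₀ (by positivity)
      rw [div_le_one (by positivity)]
      linarith [k.cast_nonneg (α := ℝ)]
    rw [EuclideanSpace.norm_eq, Real.sqrt_eq_one, Fin.sum_univ_two]
    simp only [Real.norm_eq_abs, sq_abs, Matrix.cons_val_zero, Matrix.cons_val_one]
    rw [Real.sq_sqrt (by linarith)]
    ring

theorem exists_convex_family_circle (n : ℕ) (hn : 0 < n) :
    ∃ F : Fin n → Set (EuclideanSpace ℝ (Fin 2)),
      (∀ i, Convex ℝ (F i)) ∧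
      (∀ I : Finset (Fin n), I.card ≤ n - 1 →
        ({x : EuclideanSpace ℝ (Fin 2) | ‖x‖ = 1} ∩ ⋂ i ∈ I, F i).Nonempty) ∧
      ({x : EuclideanSpace ℝ (Fin 2) | ‖x‖ = 1} ∩ ⋂ i, F i) = ∅ := by
  obtain ⟨p, hp, hp1⟩ := exists_injective_norm_eq_one
  refine ⟨fun i => convexHull ℝ ((fun j : Fin n => p j) '' {i}ᶜ), fun i => convex_convexHull ℝ _,
    fun I hI => ?_, ?_⟩
  · obtain ⟨k, hk⟩ : ∃ k, k ∉ I := by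
      by_contra! h
      rw [Finset.eq_univ_iff_forall.2 h, Finset.card_univ, Fintype.card_fin] at hI
      omega
    refine ⟨p k, hp1 k, mem_iInter₂.2 fun i hi => subset_convexHull ℝ _ ⟨k, ?_, rfl⟩⟩
    rintro rfl
    exact hk hi
  · refine eq_empty_of_forall_notMem fun x hx => ?_
    have hmem (i : Fin n) : x ∈ (fun j : Fin n => p j) '' {i}ᶜ := by
      refine mem_of_mem_convexHull_of_subset_sphere (c := 0) (r := 1) ?_
        (mem_sphere_zero_iff_norm.2 hx.1) (mem_iInter.1 hx.2 i)
      rintro _ ⟨j, -, rfl⟩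
      exact mem_sphere_zero_iff_norm.2 (hp1 j)
    obtain ⟨k, -, rfl⟩ := hmem ⟨0, hn⟩
    obtain ⟨j, hj, hjk⟩ := hmem k
    exact hj (Fin.ext (hp hjk))

/-- The unit circle `S = {x ∈ ℝ² : ‖x‖ = 1}` has infinite Helly number: for every `n ≥ 3`
there are `n` convex subsets of `ℝ²` any `n − 1` of which have a common point of `S` while
all `n` together contain no point of `S`; hence `h(S) ≤ n` fails for every `n`. -/
theorem circle_helly_infinite :
    (∀ n : ℕ, 3 ≤ n → ∃ F : Fin n → Set (EuclideanSpace ℝ (Fin 2)),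
      (∀ i, Convex ℝ (F i)) ∧
      (∀ I : Finset (Fin n), I.card ≤ n - 1 →
        ({x : EuclideanSpace ℝ (Fin 2) | ‖x‖ = 1} ∩ ⋂ i ∈ I, F i).Nonempty) ∧
      ({x : EuclideanSpace ℝ (Fin 2) | ‖x‖ = 1} ∩ ⋂ i, F i) = ∅) ∧
    ∀ n : ℕ, ¬ HellyLe {x : EuclideanSpace ℝ (Fin 2) | ‖x‖ = 1} n := by
  refine ⟨fun n hn => exists_convex_family_circle n (by omega), fun n h => ?_⟩
  obtain ⟨F, hconv, hne, hempty⟩ := exists_convex_family_circle (n + 1) n.succ_pos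
  exact (h (n + 1) F hconv hne).ne_empty hempty
end

section
/- There exists a dense subset S of ℝ³ with h(S) = ∞: a dense set S ⊆ ℝ³ such that for every n ≥ 3 there exist convex subsets F₁, …, F_n of ℝ³ such that any n−1 of them have a common point belonging to S but the intersection of all n contains no point of S. (One may take S = (ℝ³ \ {z = 0}) ∪ S₀ where S₀ is a subset of the plane {z = 0} with infinite Helly number, e.g. a circle in that plane.) In particular, the bound h(S) ≤ 4 for dense planar sets does not extend to dimension 3. -/
/-- The complement of the plane `z = 0`, together with the parabola `y = x ^ 2` in that plane. -/
def parabolaSpace : Set (EuclideanSpace ℝ (Fin 3)) :=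
  {p | p 2 ≠ 0 ∨ p 1 = p 0 ^ 2}

theorem dense_parabolaSpace : Dense parabolaSpace := by
  have hopen : IsOpenMap (EuclideanSpace.proj 2 : EuclideanSpace ℝ (Fin 3) →L[ℝ] ℝ) := by
    refine ContinuousLinearMap.isOpenMap _ fun t => ⟨WithLp.toLp 2 fun _ => t, ?_⟩
    simp
  refine ((dense_compl_singleton (0 : ℝ)).preimage hopen).mono fun p hp => Or.inl ?_
  simpa using hp

/-- The points of a planar convex hull of points of the parabola which lie in
`parabolaSpace` are the original points. -/
theorem mem_of_mem_convexHull_of_mem_parabolaSpace {A : Set (EuclideanSpace ℝ (Fin 3))}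
    (hA : ∀ p ∈ A, p 2 = 0 ∧ p 1 = p 0 ^ 2) {q : EuclideanSpace ℝ (Fin 3)}
    (hq : q ∈ parabolaSpace) (hqA : q ∈ convexHull ℝ A) : q ∈ A := by
  have hconv : Convex ℝ {p : EuclideanSpace ℝ (Fin 3) | p 2 = 0} := by
    intro x hx y hy a b _ _ _
    simp_all
  have hq2 : q 2 = 0 := convexHull_min (fun p hp => (hA p hp).1) hconv hqA
  have hq1 : q 1 = q 0 ^ 2 := hq.resolve_left (not_not_intro hq2)
  by_contra hne
  have hhalf : Convex ℝ {p : EuclideanSpace ℝ (Fin 3) | 2 * q 0 * p 0 - p 1 < q 0 ^ 2} := by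
    refine convex_halfSpace_lt ⟨fun x y => ?_, fun c x => ?_⟩ _
    · simp only [PiLp.add_apply]; ring
    · simp only [PiLp.smul_apply, smul_eq_mul]; ring
  have hlt : 2 * q 0 * q 0 - q 1 < q 0 ^ 2 := by
    refine convexHull_min (fun p hp => ?_) hhalf hqA
    obtain ⟨hp2, hp1⟩ := hA p hp
    have h0 : p 0 ≠ q 0 := by
      intro h
      have hpq : p = q := by
        ext i
        fin_cases i
        · exact h
        · simp [hp1, hq1, h]
        · simp [hp2, hq2]
      exact hne (hpq ▸ hp)
    have := sq_pos_of_ne_zero (sub_ne_zero.2 h0)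
    simp only [Set.mem_ofPred_eq, hp1]
    linarith
  linarith

/-- The point of the parabola `y = x ^ 2`, `z = 0` with first coordinate `t`. -/
noncomputable def parabolaPoint (t : ℝ) : EuclideanSpace ℝ (Fin 3) := !₂[t, t ^ 2, 0]

theorem parabolaPoint_injective : Function.Injective parabolaPoint := fun s t h => by
  simpa [parabolaPoint] using congrArg (fun p : EuclideanSpace ℝ (Fin 3) => p 0) h

theorem exists_convex_family_parabolaSpace (n : ℕ) (hn : 0 < n) :
    ∃ F : Fin n → Set (EuclideanSpace ℝ (Fin 3)),
      (∀ i, Convex ℝ (F i)) ∧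
      (∀ I : Finset (Fin n), I.card ≤ n - 1 → (parabolaSpace ∩ ⋂ i ∈ I, F i).Nonempty) ∧
      (parabolaSpace ∩ ⋂ i, F i) = ∅ := by
  let v : Fin n → EuclideanSpace ℝ (Fin 3) := fun i => parabolaPoint (i : ℕ)
  have hv : Function.Injective v := fun i j h =>
    Fin.ext (Nat.cast_injective (parabolaPoint_injective h))
  refine ⟨fun i => convexHull ℝ (v '' {i}ᶜ), fun i => convex_convexHull ℝ _, fun I hI => ?_, ?_⟩
  · obtain ⟨j, hj⟩ : ∃ j, j ∉ I := by
      by_contra! h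
      have hcard := Finset.card_eq_iff_eq_univ I |>.2 (Finset.eq_univ_of_forall h)
      rw [Fintype.card_fin] at hcard
      omega
    refine ⟨v j, Or.inr (by simp [v, parabolaPoint]), Set.mem_iInter₂.2 fun i hi => ?_⟩
    refine subset_convexHull ℝ _ ⟨j, ?_, rfl⟩
    rintro rfl
    exact hj hi
  · refine Set.eq_empty_of_forall_notMem ?_
    rintro q ⟨hqS, hqF⟩
    have hmem (i : Fin n) : q ∈ v '' {i}ᶜ := by
      refine mem_of_mem_convexHull_of_mem_parabolaSpace ?_ hqS (Set.mem_iInter.1 hqF i)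
      rintro _ ⟨j, -, rfl⟩
      simp [v, parabolaPoint]
    obtain ⟨j, -, hj⟩ := hmem ⟨0, hn⟩
    obtain ⟨k, hk, hkq⟩ := hmem j
    exact hk (hv (hkq.trans hj.symm))

/-- There exists a dense subset `S` of `ℝ³` with infinite Helly number: for every `n ≥ 3`
there are `n` convex subsets of `ℝ³` any `n − 1` of which have a common point of `S` while
all `n` together contain no point of `S`; in particular `h(S) ≤ n` fails for every `n`. -/
theorem dense_in_R3_infinite_helly :
    ∃ S : Set (EuclideanSpace ℝ (Fin 3)),
      Dense S ∧
      (∀ n : ℕ, 3 ≤ n → ∃ F : Fin n → Set (EuclideanSpace ℝ (Fin 3)),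
        (∀ i, Convex ℝ (F i)) ∧
        (∀ I : Finset (Fin n), I.card ≤ n - 1 → (S ∩ ⋂ i ∈ I, F i).Nonempty) ∧
        (S ∩ ⋂ i, F i) = ∅) ∧
      ∀ n : ℕ, ¬ HellyLe S n := by
  refine ⟨parabolaSpace, dense_parabolaSpace,
    fun n hn => exists_convex_family_parabolaSpace n (by omega), fun n hn => ?_⟩
  obtain ⟨F, hconv, hsub, hempty⟩ := exists_convex_family_parabolaSpace (n + 1) n.succ_pos
  exact (hn (n + 1) F hconv hsub).ne_empty hempty
end

section
/- Let S be an additive subgroup of ℝ^d generated by m elements, i.e., there exist g₁, …, g_m ∈ ℝ^d such that S = {a₁g₁ + ⋯ + a_m g_m : a₁, …, a_m ∈ ℤ}. Then h(S) ≤ 2^m; that is, for every finite family F₁, …, F_m' of convex subsets of ℝ^d, if every subfamily of at most 2^m of the sets has a common point belonging to S, then all the sets have a common point belonging to S. -/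
/-- Two of more than `2 ^ m` integer vectors agree modulo two, so their midpoint is integral. -/
theorem exists_ne_add_eq_two_nsmul {ι : Type*} [Fintype ι] {m : ℕ}
    (hι : 2 ^ m < Fintype.card ι) (x : ι → Fin m → ℤ) :
    ∃ i j, i ≠ j ∧ ∃ z : Fin m → ℤ, x i + x j = 2 • z := by
  obtain ⟨i, j, hij, h⟩ := Fintype.exists_ne_map_eq_of_card_lt
    (fun i (k : Fin m) => (x i k : ZMod 2)) (by simpa [ZMod.card] using hι)
  refine ⟨i, j, hij, fun k => (x i k + x j k) / 2, ?_⟩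
  funext k
  have hk : x i k ≡ x j k [ZMOD 2] := (ZMod.intCast_eq_intCast_iff _ _ 2).1 (congrFun h k)
  simp only [Int.ModEq] at hk
  simp only [Pi.add_apply, Pi.smul_apply, nsmul_eq_mul, Nat.cast_ofNat]
  omega

/-- If more than `2 ^ m` open half-spaces are such that, whenever one of them is omitted, the others
share a point of a finite midpoint-closed set of integer vectors, then all of them do. -/
theorem exists_forall_lt_of_two_pow_lt_card {ι : Type*} [Fintype ι] {m : ℕ}
    (hι : 2 ^ m < Fintype.card ι) {X : Finset (Fin m → ℤ)}
    (hX : ∀ x ∈ X, ∀ y ∈ X, ∀ z, x + y = 2 • z → z ∈ X)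
    (f : ι → (Fin m → ℤ) →+ ℝ) (b : ι → ℝ)
    (h : ∀ i, ∃ x ∈ X, ∀ j, j ≠ i → f j x < b j) :
    ∃ x ∈ X, ∀ i, f i x < b i := by
  classical
  by_contra! hn
  let P : Set (ι → ℝ) := {c | b ≤ c ∧ ∀ x ∈ X, ∃ i, c i ≤ f i x}
  let w (c : ι → ℝ) : ℕ := ∑ i, (X.filter fun x => f i x < c i).card
  -- Push the half-spaces outwards as far as possible while no point of `X` lies in all of them.
  obtain ⟨c, ⟨hbc, hc⟩, hmax⟩ : ∃ c ∈ P, ∀ c' ∈ P, w c' ≤ w c := by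
    have hw : ∀ c, w c ≤ ∑ _i : ι, X.card := fun c =>
      Finset.sum_le_sum fun i _ => Finset.card_filter_le _ _
    obtain ⟨c, hcP, hc⟩ := WellFounded.has_min
      (measure fun c => (∑ _i : ι, X.card) - w c).wf P ⟨b, le_rfl, hn⟩
    refine ⟨c, hcP, fun c' hc' => ?_⟩
    have h₁ : ¬ (∑ _i : ι, X.card) - w c' < (∑ _i : ι, X.card) - w c := hc c' hc'
    have h₂ := hw c
    have h₃ := hw c'
    omega
  have hmin : ∀ i, ∃ x ∈ X, (∀ j, j ≠ i → f j x < c j) ∧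
      ∀ y ∈ X, (∀ j, j ≠ i → f j y < c j) → f i x ≤ f i y := by
    intro i
    obtain ⟨x₀, hx₀, hx₀'⟩ := h i
    obtain ⟨x, hx, hx'⟩ := Finset.exists_min_image
      (X.filter fun x => ∀ j, j ≠ i → f j x < c j) (f i)
      ⟨x₀, Finset.mem_filter.2 ⟨hx₀, fun j hj => (hx₀' j hj).trans_le (hbc j)⟩⟩
    obtain ⟨hxX, hxc⟩ := Finset.mem_filter.1 hx
    exact ⟨x, hxX, hxc, fun y hy hyc => hx' y (Finset.mem_filter.2 ⟨hy, hyc⟩)⟩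
  choose x hxX hxc hxmin using hmin
  have hle : ∀ i, c i ≤ f i (x i) := by
    intro i
    obtain ⟨j, hj⟩ := hc _ (hxX i)
    by_cases hji : j = i
    · exact hji ▸ hj
    · exact absurd (hxc i j hji) hj.not_gt
  have hlt : ∀ i, ∀ y ∈ X, f i y < f i (x i) → f i y < c i := by
    intro i y hy hyx
    by_contra hyc
    have hcc' : c ≤ Function.update c i (f i (x i)) := by
      intro j
      by_cases hji : j = i
      · subst hji
        simpa using hle j
      · simp [hji]
    have hmem : Function.update c i (f i (x i)) ∈ P := by
      refine ⟨hbc.trans hcc', fun z hz => ?_⟩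
      by_cases hzc : ∀ j, j ≠ i → f j z < c j
      · exact ⟨i, by simpa using hxmin i z hz hzc⟩
      · push Not at hzc
        obtain ⟨j, hji, hj⟩ := hzc
        exact ⟨j, by simpa [hji] using hj⟩
    refine (hmax _ hmem).not_gt (Finset.sum_lt_sum (fun j _ => ?_) ⟨i, Finset.mem_univ i, ?_⟩)
    · exact Finset.card_le_card (Finset.monotone_filter_right _
        fun z _ hz => lt_of_lt_of_le hz (hcc' j))
    · refine Finset.card_lt_card (Finset.ssubset_iff_of_subset
        (Finset.monotone_filter_right _ fun z _ hz => lt_of_lt_of_le hz (hcc' i)) |>.2 ⟨y, ?_, ?_⟩)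
      · simpa [hy] using hyx
      · simpa [hy] using hyc
  obtain ⟨i, j, hij, z, hz⟩ := exists_ne_add_eq_two_nsmul hι x
  have hzX := hX _ (hxX i) _ (hxX j) z hz
  have hfz : ∀ k, f k (x i) + f k (x j) = 2 * f k z := by
    intro k
    rw [← map_add, hz, map_nsmul, nsmul_eq_mul, Nat.cast_ofNat]
  obtain ⟨k, hk⟩ := hc z hzX
  have hkz := hfz k
  refine hk.not_gt ?_
  by_cases hki : k = i
  · subst hki
    refine hlt k z hzX ?_
    linarith [hxc j k hij, hle k]
  · by_cases hkj : k = j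
    · subst hkj
      refine hlt k z hzX ?_
      linarith [hxc i k hki, hle k]
    · linarith [hxc i k hki, hxc j k hkj]

/-- Doignon's theorem for open half-spaces and a finite midpoint-closed set of integer vectors. -/
theorem exists_forall_lt_of_forall_card_le {ι : Type*} {m : ℕ} {X : Finset (Fin m → ℤ)}
    (hX : ∀ x ∈ X, ∀ y ∈ X, ∀ z, x + y = 2 • z → z ∈ X)
    (f : ι → (Fin m → ℤ) →+ ℝ) (b : ι → ℝ) (T : Finset ι)
    (h : ∀ I ⊆ T, I.card ≤ 2 ^ m → ∃ x ∈ X, ∀ i ∈ I, f i x < b i) :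
    ∃ x ∈ X, ∀ i ∈ T, f i x < b i := by
  classical
  induction T using Finset.strongInduction with
  | H T ih =>
    by_cases hT : T.card ≤ 2 ^ m
    · exact h T subset_rfl hT
    · obtain ⟨x, hx, hx'⟩ := exists_forall_lt_of_two_pow_lt_card (ι := T)
        (by simpa using hT) hX (fun i => f i) (fun i => b i) fun i => by
          obtain ⟨x, hx, hx'⟩ := ih (T.erase i) (Finset.erase_ssubset i.2)
            fun I hI => h I (hI.trans (Finset.erase_subset _ _))
          exact ⟨x, hx, fun j hj =>
            hx' j (Finset.mem_erase.2 ⟨fun e => hj (Subtype.ext e), j.2⟩)⟩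
      exact ⟨x, hx, fun i hi => hx' ⟨i, hi⟩⟩

/-- Finitely many integer vectors lie in a common finite midpoint-closed set. -/
theorem exists_finset_midpoint_closed {m : ℕ} (A : Finset (Fin m → ℤ)) :
    ∃ X : Finset (Fin m → ℤ), A ⊆ X ∧ ∀ x ∈ X, ∀ y ∈ X, ∀ z, x + y = 2 • z → z ∈ X := by
  obtain ⟨lo, hlo⟩ := A.bddBelow
  obtain ⟨hi, hhi⟩ := A.bddAbove
  refine ⟨Finset.Icc lo hi, fun x hx => Finset.mem_Icc.2 ⟨hlo hx, hhi hx⟩, ?_⟩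
  intro x hx y hy z hz
  rw [Finset.mem_Icc] at hx hy ⊢
  suffices h : ∀ k, lo k ≤ z k ∧ z k ≤ hi k from forall_and.1 h
  intro k
  have h₁ := congrFun hz k
  have h₂ : lo k ≤ x k := hx.1 k
  have h₃ : x k ≤ hi k := hx.2 k
  have h₄ : lo k ≤ y k := hy.1 k
  have h₅ : y k ≤ hi k := hy.2 k
  simp only [Pi.add_apply, Pi.smul_apply, nsmul_eq_mul, Nat.cast_ofNat] at h₁
  omega

/-- If `S` is the additive subgroup of `ℝ^d` generated by `m` elements `g₁, …, g_m`,
i.e. the set of all integer linear combinations of the `g i`, then `h(S) ≤ 2^m`. -/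
theorem helly_finitely_generated_group (d m : ℕ) (g : Fin m → EuclideanSpace ℝ (Fin d)) :
    HellyLe {x : EuclideanSpace ℝ (Fin d) | ∃ a : Fin m → ℤ, x = ∑ i, a i • g i} (2 ^ m) := by
  classical
  intro n F hF hI
  let φ : (Fin m → ℤ) →+ EuclideanSpace ℝ (Fin d) :=
    { toFun := fun a => ∑ i, a i • g i
      map_zero' := by simp
      map_add' := fun a a' => by simp [add_smul, Finset.sum_add_distrib] }
  have hz : ∀ I : Finset (Fin n), ∃ a : Fin m → ℤ, I.card ≤ 2 ^ m → ∀ i ∈ I, φ a ∈ F i := by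
    intro I
    by_cases hc : I.card ≤ 2 ^ m
    · obtain ⟨_, ⟨a, rfl⟩, ha⟩ := hI I hc
      exact ⟨a, fun _ i hi => Set.mem_iInter₂.1 ha i hi⟩
    · exact ⟨0, fun h => absurd h hc⟩
  choose z hz using hz
  obtain ⟨X, hzX, hX⟩ := exists_finset_midpoint_closed (Finset.univ.image z)
  let V (i : Fin n) : Set (EuclideanSpace ℝ (Fin d)) :=
    (fun I => φ (z I)) '' {I | I.card ≤ 2 ^ m ∧ i ∈ I}
  have hVF : ∀ i, convexHull ℝ (V i) ⊆ F i := by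
    refine fun i => convexHull_min ?_ (hF i)
    rintro _ ⟨I, ⟨hc, hi⟩, rfl⟩
    exact hz I hc i hi
  by_contra hne
  have hsep : ∀ x : Fin m → ℤ, ∃ (i : Fin n) (f : (Fin m → ℤ) →+ ℝ) (b : ℝ),
      (∀ I : Finset (Fin n), I.card ≤ 2 ^ m → i ∈ I → f (z I) < b) ∧ b < f x := by
    intro x
    obtain ⟨i, hi⟩ : ∃ i, φ x ∉ F i := by
      by_contra! hx
      exact hne ⟨φ x, ⟨x, rfl⟩, Set.mem_iInter.2 hx⟩
    obtain ⟨f, b, hfb, hb⟩ := geometric_hahn_banach_closed_point (convex_convexHull ℝ (V i))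
      (((Set.toFinite _).image _).isClosed_convexHull (𝕜 := ℝ)) fun h => hi (hVF i h)
    exact ⟨i, (f : EuclideanSpace ℝ (Fin d) →+ ℝ).comp φ, b,
      fun I hc hi => hfb _ (subset_convexHull ℝ _ ⟨I, ⟨hc, hi⟩, rfl⟩), hb⟩
  choose i f b hfb hb using hsep
  obtain ⟨x, hx, hx'⟩ := exists_forall_lt_of_forall_card_le hX f b X fun T _ hT =>
    ⟨z (T.image i), hzX (Finset.mem_image_of_mem _ (Finset.mem_univ _)), fun y hy =>
      hfb y _ (Finset.card_image_le.trans hT) (Finset.mem_image_of_mem _ hy)⟩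
  exact (hx' x hx).not_gt (hb x)
end
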